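/- Let Γ be a distance-regular graph with classical parameters (D, b, α, β) such that b ≥ 2, α = 0 and D ≥ 3, and let r = [D]. Then β < 2·((b+2)/(2b+3))·(b³ + 2b² + 3b − 1)·r. -/

import Mathlib

open SimpleGraph

namespace DRGPaper

variable {V : Type*}

/-- `Γ` is a distance-regular graph with diameter `D` and intersection arrays `cc`, `aa`, `bb`:
`Γ` is connected of diameter `D` and for any vertices `x, y` at distance `i ≤ D`, `y` has exactly
`cc i` neighbours at distance `i - 1` from `x`, `aa i` neighbours at distance `i` from `x`,
and `bb i` neighbours at distance `i + 1` from `x`. -/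
def IsDRG [Fintype V] (G : SimpleGraph V) (D : ℕ) (cc aa bb : ℕ → ℕ) : Prop :=
  G.Connected ∧
  (∀ x y : V, G.dist x y ≤ D) ∧
  (∃ x y : V, G.dist x y = D) ∧
  ∀ i : ℕ, i ≤ D → ∀ x y : V, G.dist x y = i →
    {z : V | G.Adj y z ∧ G.dist x z = i - 1}.ncard = cc i ∧
    {z : V | G.Adj y z ∧ G.dist x z = i}.ncard = aa i ∧
    {z : V | G.Adj y z ∧ G.dist x z = i + 1}.ncard = bb i

/-- `[j] = (b^j - 1)/(b - 1) = 1 + b + ⋯ + b^(j-1)` as a real number. -/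
def gauss (b j : ℕ) : ℝ := ∑ i ∈ Finset.range j, (b : ℝ) ^ i

/-- `Γ` has classical parameters `(D, b, α, β)`: it is distance-regular of diameter `D` with
`bb i = ([D] - [i])(β - α[i])` for `0 ≤ i ≤ D - 1` and `cc i = [i](1 + α[i-1])` for
`1 ≤ i ≤ D`. -/
def HasClassicalParams [Fintype V] (G : SimpleGraph V) (D b : ℕ) (α β : ℝ)
    (cc aa bb : ℕ → ℕ) : Prop :=
  IsDRG G D cc aa bb ∧
  (∀ i : ℕ, i ≤ D - 1 → (bb i : ℝ) = (gauss b D - gauss b i) * (β - α * gauss b i)) ∧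
  (∀ i : ℕ, 1 ≤ i → i ≤ D → (cc i : ℝ) = gauss b i * (1 + α * gauss b (i - 1)))

/-- `d(x, C) = min {d(x, y) : y ∈ C}`. -/
noncomputable def distToSet (G : SimpleGraph V) (x : V) (C : Set V) : ℕ :=
  sInf (G.dist x '' C)

/-- A maximal clique of `G`. -/
def IsMaxClique (G : SimpleGraph V) (s : Set V) : Prop :=
  G.IsClique s ∧ ∀ t : Set V, G.IsClique t → s ⊆ t → t = s

/-- The lines for the PLS(γ) property: maximal cliques with at least `γ` vertices. -/
def plsLines (G : SimpleGraph V) (γ : ℕ) : Set (Set V) :=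
  {ℓ : Set V | IsMaxClique G ℓ ∧ γ ≤ ℓ.ncard}

/-- `G` is the point graph of the partial linear space with line set `L`: any two adjacent
vertices lie on exactly one common line of `L`. -/
def IsPointGraphOf (G : SimpleGraph V) (L : Set (Set V)) : Prop :=
  ∀ x y : V, G.Adj x y → ∃! ℓ : Set V, ℓ ∈ L ∧ x ∈ ℓ ∧ y ∈ ℓ

/-- A vertex is a Delsarte vertex (w.r.t. the line set `L` and classical parameter `β`) if all
lines through it have exactly `β + 1` vertices. -/
def IsDelsarteVertex (L : Set (Set V)) (β : ℝ) (x : V) : Prop :=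
  ∀ ℓ ∈ L, x ∈ ℓ → (ℓ.ncard : ℝ) = β + 1

/-- The lines for the SPLS(c, s) property: maximal cliques with at least
`a1 + 2 - (c - 1)(s - 1)` vertices. -/
def splsLines (G : SimpleGraph V) (a1 c s : ℕ) : Set (Set V) :=
  {ℓ : Set V | IsMaxClique G ℓ ∧ (a1 : ℤ) + 2 - ((c : ℤ) - 1) * ((s : ℤ) - 1) ≤ (ℓ.ncard : ℤ)}

/-- The SPLS(c, s) property: `G` is the point graph of the partial linear space whose lines are
the maximal cliques with at least `a1 + 2 - (c-1)(s-1)` vertices, `a1 ≥ (2s-1)(c-1)`, each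
vertex lies on at most `s` lines, and every point not on a line `ℓ` is collinear with at most
`c` points of `ℓ`.  SPLS(s) is the case `c = c₂`. -/
def HasSPLS (G : SimpleGraph V) (a1 c s : ℕ) : Prop :=
  1 ≤ c ∧ 2 ≤ s ∧
  (2 * (s : ℤ) - 1) * ((c : ℤ) - 1) ≤ (a1 : ℤ) ∧
  IsPointGraphOf G (splsLines G a1 c s) ∧
  (∀ x : V, {ℓ ∈ splsLines G a1 c s | x ∈ ℓ}.ncard ≤ s) ∧
  (∀ ℓ ∈ splsLines G a1 c s, ∀ x : V, x ∉ ℓ → {y ∈ ℓ | G.Adj x y}.ncard ≤ c)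

/-- `[x, y]`: the set of lines `ℓ ∈ L` through `x` such that `d(y, u) ≤ 2` for all `u ∈ ℓ`. -/
def lineXY (G : SimpleGraph V) (L : Set (Set V)) (x y : V) : Set (Set V) :=
  {ℓ ∈ L | x ∈ ℓ ∧ ∀ u ∈ ℓ, G.dist y u ≤ 2}

/-- `𝓒` witnesses that `G` is geometric with cliques of order `q`: every member of `𝓒` is a
clique with exactly `q` vertices and every edge of `G` lies in a unique member of `𝓒`. -/
def IsGeomLineSet (G : SimpleGraph V) (q : ℝ) (𝓒 : Set (Set V)) : Prop :=
  (∀ C ∈ 𝓒, G.IsClique C ∧ (C.ncard : ℝ) = q) ∧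
  ∀ x y : V, G.Adj x y → ∃! C : Set V, C ∈ 𝓒 ∧ x ∈ C ∧ y ∈ C

/-- `G` is geometric: there is a set of Delsarte cliques (cliques of the maximum order `q`)
such that every edge lies in a unique member. -/
def IsGeometric (G : SimpleGraph V) (q : ℝ) : Prop :=
  ∃ 𝓒 : Set (Set V), IsGeomLineSet G q 𝓒

/-- An assembly: a maximal clique which is not a line. -/
def IsAssembly (G : SimpleGraph V) (𝓒 : Set (Set V)) (M : Set V) : Prop :=
  IsMaxClique G M ∧ M ∉ 𝓒

/-- The dual Pasch axiom: for every pair of adjacent vertices `x, y`, the common neighbours of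
`x` and `y` outside the (any) line of `𝓒` through `x` and `y` form a clique. -/
def DualPasch (G : SimpleGraph V) (𝓒 : Set (Set V)) : Prop :=
  ∀ x y : V, G.Adj x y → ∀ ℓ ∈ 𝓒, x ∈ ℓ → y ∈ ℓ →
    G.IsClique {z : V | G.Adj x z ∧ G.Adj y z ∧ z ∉ ℓ}

/-- The `m × n` grid, i.e. the Cartesian product `K_m □ K_n`. -/
def gridGraph (m n : ℕ) : SimpleGraph (Fin m × Fin n) :=
  (⊤ : SimpleGraph (Fin m)).boxProd (⊤ : SimpleGraph (Fin n))

/-- The `A`-clique extension of a graph `H`: replace every vertex of `H` by a clique of size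
`A`, vertices in distinct cliques being adjacent exactly when the underlying vertices of `H`
are adjacent. -/
def cliqueExt {W : Type*} (H : SimpleGraph W) (A : ℕ) : SimpleGraph (W × Fin A) :=
  SimpleGraph.fromRel (fun p q => H.Adj p.1 q.1 ∨ p.1 = q.1)

/-- `θ` is an eigenvalue of the adjacency matrix of `G`. -/
def IsAdjEigenvalue [Fintype V] (G : SimpleGraph V) [DecidableRel G.Adj] (θ : ℝ) : Prop :=
  ∃ v : V → ℝ, v ≠ 0 ∧ (G.adjMatrix ℝ).mulVec v = θ • v

section

open scoped Classical
open Finset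

set_option linter.unusedSectionVars false

variable [Fintype V] {G : SimpleGraph V} {r b s : ℕ}

/-- The parameters of a distance-regular graph with classical parameters `(D, b, 0, s)`,
`D ≥ 3`, that concern pairs of vertices at distance at most three; here `r = [D]`. -/
structure LocalParams (G : SimpleGraph V) (r b s : ℕ) : Prop where
  conn : G.Connected
  deg : ∀ x, #{z | G.Adj x z} = r * s
  common_adj : ∀ x y, G.Adj x y → #{z | G.Adj x z ∧ G.Adj y z} + 1 = s
  common_two : ∀ x y, G.dist x y = 2 → #{z | G.Adj x z ∧ G.Adj y z} = b + 1
  two_two : ∀ x y, G.dist x y = 2 → #{z | G.Adj y z ∧ G.dist x z = 2} + (b + 1) = (b + 1) * s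
  three_two : ∀ x y, G.dist x y = 3 → #{z | G.Adj y z ∧ G.dist x z = 2} = b ^ 2 + b + 1

namespace LocalParams

lemma dist_le_two (P : LocalParams G r b s) {x y z : V} (h₁ : G.Adj x y) (h₂ : G.Adj y z) :
    G.dist x z ≤ 2 := by
  have := P.conn.dist_triangle (u := x) (v := y) (w := z)
  rw [dist_eq_one_iff_adj.2 h₁, dist_eq_one_iff_adj.2 h₂] at this
  exact this

lemma dist_eq_two (P : LocalParams G r b s) {x z : V} (hd : G.dist x z ≤ 2) (hne : x ≠ z)
    (hna : ¬ G.Adj x z) : G.dist x z = 2 := by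
  have h0 : G.dist x z ≠ 0 := fun h => hne (P.conn.dist_eq_zero_iff.1 h)
  have h1 : G.dist x z ≠ 1 := fun h => hna (dist_eq_one_iff_adj.1 h)
  omega

lemma card_common_le (P : LocalParams G r b s) {x y : V} (hne : x ≠ y) (hna : ¬ G.Adj x y) :
    #{z | G.Adj x z ∧ G.Adj y z} ≤ b + 1 := by
  by_cases h : ∃ z, G.Adj x z ∧ G.Adj y z
  · obtain ⟨z, hx, hy⟩ := h
    exact (P.common_two x y (P.dist_eq_two (P.dist_le_two hx hy.symm) hne hna)).le
  · push Not at h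
    rw [filter_eq_empty_iff.2 (by simpa using h)]
    simp

lemma card_common_inner_le (P : LocalParams G r b s) {x y z : V} (hy : G.Adj x y)
    (hz : G.Adj x z) (hne : y ≠ z) (hna : ¬ G.Adj y z) :
    #{w | G.Adj x w ∧ G.Adj y w ∧ G.Adj z w} ≤ b := by
  have h : insert x (univ.filter fun w => G.Adj x w ∧ G.Adj y w ∧ G.Adj z w) ⊆
      univ.filter fun w => G.Adj y w ∧ G.Adj z w := by
    intro w hw
    simp only [mem_insert, mem_filter, mem_univ, true_and] at hw ⊢
    rcases hw with rfl | hw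
    · exact ⟨hy.symm, hz.symm⟩
    · exact hw.2
  have h' := card_le_card h
  rw [card_insert_of_notMem (by simp)] at h'
  have := P.card_common_le hne hna
  omega

lemma card_closed_inner (P : LocalParams G r b s) {x y : V} (hy : G.Adj x y) :
    #{w | G.Adj x w ∧ (w = y ∨ G.Adj y w)} = s := by
  have h : (univ.filter fun w => G.Adj x w ∧ (w = y ∨ G.Adj y w)) =
      insert y (univ.filter fun w => G.Adj x w ∧ G.Adj y w) := by
    ext w
    simp only [mem_insert, mem_filter, mem_univ, true_and]
    constructor
    · tauto
    · rintro (rfl | h) <;> tauto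
  rw [h, card_insert_of_notMem (by simp), P.common_adj x y hy]

end LocalParams

/-- An independent set of neighbours of `x`. -/
def IsClaw (G : SimpleGraph V) (x : V) (S : Finset V) : Prop :=
  (∀ y ∈ S, G.Adj x y) ∧ ∀ y ∈ S, ∀ z ∈ S, y ≠ z → ¬ G.Adj y z

namespace LocalParams

lemma claw_union_bound (P : LocalParams G r b s) (x : V) (S : Finset V) (hS : IsClaw G x S) :
    2 * #S * s + #S * b ≤
      2 * #{z | G.Adj x z ∧ ∃ y ∈ S, z = y ∨ G.Adj y z} + #S ^ 2 * b := by
  induction S using Finset.induction_on with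
  | empty => simp
  | insert y T hy ih =>
    have hT : IsClaw G x T :=
      ⟨fun z hz => hS.1 z (mem_insert_of_mem hz), fun z hz w hw =>
        hS.2 z (mem_insert_of_mem hz) w (mem_insert_of_mem hw)⟩
    specialize ih hT
    have hxy : G.Adj x y := hS.1 y (mem_insert_self _ _)
    set U : Finset V := {z | G.Adj x z ∧ ∃ y ∈ T, z = y ∨ G.Adj y z} with hU
    set W : Finset V := {w | G.Adj x w ∧ (w = y ∨ G.Adj y w)} with hW
    have hWc : #W = s := P.card_closed_inner hxy
    have hUW : ({z | G.Adj x z ∧ ∃ w ∈ insert y T, z = w ∨ G.Adj w z} : Finset V) = U ∪ W := by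
      ext z
      simp only [hU, hW, mem_insert, mem_filter, mem_univ, true_and, mem_union, exists_eq_or_imp]
      rw [and_or_left, or_comm]
    have hI : #(U ∩ W) ≤ #T * b := by
      refine (card_le_card (t := T.biUnion fun z => {w | G.Adj x w ∧ G.Adj z w ∧ G.Adj y w})
        ?_).trans (card_biUnion_le_card_mul _ _ _ fun z hz => ?_)
      · intro w hw
        simp only [hU, hW, mem_inter, mem_filter, mem_univ, true_and, mem_biUnion] at hw ⊢
        obtain ⟨⟨hxw, z, hz, hzw⟩, -, hyw⟩ := hw
        have hzy : z ≠ y := fun h => hy (h ▸ hz)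
        have hna := hS.2 z (mem_insert_of_mem hz) y (mem_insert_self _ _) hzy
        refine ⟨z, hz, hxw, ?_, ?_⟩
        · rcases hzw with rfl | h
          · rcases hyw with rfl | h'
            · exact (hzy rfl).elim
            · exact (hna h'.symm).elim
          · exact h
        · rcases hyw with rfl | h'
          · rcases hzw with rfl | h
            · exact (hzy rfl).elim
            · exact (hna h).elim
          · exact h'
      · have hzy : z ≠ y := fun h => hy (h ▸ hz)
        exact P.card_common_inner_le (hT.1 z hz) hxy hzy
          (hS.2 z (mem_insert_of_mem hz) y (mem_insert_self _ _) hzy)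
    have hc := card_union_add_card_inter U W
    rw [hUW, card_insert_of_notMem hy]
    nlinarith

lemma claw_card_lt (P : LocalParams G r b s) (hr : 1 ≤ r) (hs : 2 * r * (b + 1) ^ 2 ≤ s)
    {x : V} {S : Finset V} (hS : IsClaw G x S) : #S < 2 * r := by
  by_contra! hlt
  obtain ⟨T, hTS, hT⟩ := exists_subset_card_eq hlt
  have hTc : IsClaw G x T := ⟨fun z hz => hS.1 z (hTS hz), fun z hz w hw =>
        hS.2 z (hTS hz) w (hTS hw)⟩
  have h := P.claw_union_bound x T hTc
  have hU : #{z | G.Adj x z ∧ ∃ y ∈ T, z = y ∨ G.Adj y z} ≤ r * s := by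
    rw [← P.deg x]
    exact card_le_card (fun z => by simp +contextual)
  rw [hT] at h
  have h2 : r * (s + b) ≤ r * (2 * r * b) := by nlinarith
  have h3 : s + b ≤ 2 * r * b := Nat.le_of_mul_le_mul_left h2 hr
  nlinarith

/-- If `β` is large, then every edge lies in a large clique. -/
lemma exists_large_clique (P : LocalParams G r b s) (hr : 1 ≤ r) (hs : 2 * r * (b + 1) ^ 2 ≤ s)
    {x y : V} (hxy : G.Adj x y) :
    ∃ C : Finset V, G.IsClique C ∧ x ∈ C ∧ y ∈ C ∧ s + 1 + 2 * b ≤ #C + 2 * r * b := by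
  obtain ⟨S, hSmem, hSmax⟩ := exists_max_image
    (univ.filter fun S : Finset V => IsClaw G x S) card
    ⟨∅, mem_filter.2 ⟨mem_univ _, by simp [IsClaw]⟩⟩
  have hS : IsClaw G x S := by simpa using hSmem
  have hmax : ∀ T, IsClaw G x T → #T ≤ #S := fun T hT => hSmax T (by simpa using hT)
  have hSr := P.claw_card_lt hr hs hS
  set C : V → Finset V := fun i =>
    {z | G.Adj x z ∧ (z = i ∨ G.Adj i z) ∧ ∀ j ∈ S, j ≠ i → ¬ G.Adj j z} with hC
  have memC : ∀ i z, z ∈ C i ↔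
      G.Adj x z ∧ (z = i ∨ G.Adj i z) ∧ ∀ j ∈ S, j ≠ i → ¬ G.Adj j z := by simp [hC]
  have hCcard : ∀ i ∈ S, s + b ≤ #(C i) + #S * b := by
    intro i hi
    have hsub : ({w | G.Adj x w ∧ (w = i ∨ G.Adj i w)} : Finset V) ⊆
        C i ∪ (S.erase i).biUnion fun j => {w | G.Adj x w ∧ G.Adj i w ∧ G.Adj j w} := by
      intro w hw
      simp only [mem_filter, mem_univ, true_and] at hw
      simp only [mem_union, memC, mem_biUnion, mem_erase, mem_filter, mem_univ, true_and]
      by_cases h : ∀ j ∈ S, j ≠ i → ¬ G.Adj j w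
      · exact Or.inl ⟨hw.1, hw.2, h⟩
      · push Not at h
        obtain ⟨j, hj, hji, hjw⟩ := h
        refine Or.inr ⟨j, ⟨hji, hj⟩, hw.1, ?_, hjw⟩
        rcases hw.2 with rfl | h'
        · exact (hS.2 j hj w hi hji hjw).elim
        · exact h'
    have h1 := (card_le_card hsub).trans (card_union_le _ _)
    rw [P.card_closed_inner (hS.1 i hi)] at h1
    have h2 : #((S.erase i).biUnion fun j => {w | G.Adj x w ∧ G.Adj i w ∧ G.Adj j w})
        ≤ #(S.erase i) * b := by
      refine card_biUnion_le_card_mul _ _ _ fun j hj => ?_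
      rw [mem_erase] at hj
      exact P.card_common_inner_le (hS.1 i hi) (hS.1 j hj.2) hj.1.symm
        (hS.2 i hi j hj.2 hj.1.symm)
    have h3 := card_erase_add_one hi
    nlinarith
  have hCself : ∀ i ∈ S, i ∈ C i := fun i hi =>
    (memC i i).2 ⟨hS.1 i hi, Or.inl rfl, fun j hj hji => hS.2 j hj i hi hji⟩
  have hCdisj : ∀ i ∈ S, ∀ j ∈ S, i ≠ j → ∀ z ∈ C j, z ≠ i ∧ ¬ G.Adj z i := by
    intro i hi j hj hij z hz
    rw [memC] at hz
    refine ⟨?_, fun h => hz.2.2 i hi hij h.symm⟩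
    rintro rfl
    rcases hz.2.1 with rfl | h
    · exact hij rfl
    · exact hS.2 j hj z hi hij.symm h
  have hCclique : ∀ i ∈ S, ∀ z ∈ C i, ∀ w ∈ C i, z ≠ w → G.Adj z w := by
    intro i hi z hz w hw hzw
    by_contra hna
    have hz' : z ∉ S.erase i := fun h =>
      (hCdisj z (mem_of_mem_erase h) i hi (ne_of_mem_erase h) z hz).1 rfl
    have hw' : w ∉ S.erase i := fun h =>
      (hCdisj w (mem_of_mem_erase h) i hi (ne_of_mem_erase h) w hw).1 rfl
    have hclaw : IsClaw G x (insert z (insert w (S.erase i))) := by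
      rw [memC] at hz hw
      constructor
      · intro v hv
        simp only [mem_insert, mem_erase] at hv
        rcases hv with rfl | rfl | hv
        exacts [hz.1, hw.1, hS.1 v hv.2]
      · intro u hu v hv huv
        simp only [mem_insert, mem_erase] at hu hv
        rcases hu with rfl | rfl | hu <;> rcases hv with rfl | rfl | hv
        · exact (huv rfl).elim
        · exact hna
        · exact fun h => hz.2.2 v hv.2 hv.1 h.symm
        · exact fun h => hna h.symm
        · exact (huv rfl).elim
        · exact fun h => hw.2.2 v hv.2 hv.1 h.symm
        · exact hz.2.2 u hu.2 hu.1
        · exact hw.2.2 u hu.2 hu.1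
        · exact hS.2 u hu.2 v hv.2 huv
    have h1 := hmax _ hclaw
    rw [card_insert_of_notMem (by simp only [mem_insert, not_or]; exact ⟨hzw, hz'⟩),
      card_insert_of_notMem hw', card_erase_add_one hi] at h1
    omega
  by_cases hcase : ∃ i ∈ S, ∀ z ∈ C i, z = y ∨ G.Adj y z
  · obtain ⟨i, hi, hiy⟩ := hcase
    refine ⟨insert x (insert y (C i)), ?_, by simp, by simp, ?_⟩
    · intro u hu v hv huv
      simp only [coe_insert, Set.mem_insert_iff, mem_coe] at hu hv
      rcases hu with rfl | rfl | hu <;> rcases hv with rfl | rfl | hv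
      · exact (huv rfl).elim
      · exact hxy
      · exact ((memC _ _).1 hv).1
      · exact hxy.symm
      · exact (huv rfl).elim
      · rcases hiy v hv with rfl | h
        exacts [(huv rfl).elim, h]
      · exact ((memC _ _).1 hu).1.symm
      · rcases hiy u hu with rfl | h
        exacts [(huv rfl).elim, h.symm]
      · exact hCclique i hi u hu v hv huv
    · have hx : x ∉ insert y (C i) := by
        simp only [mem_insert, memC, not_or]
        exact ⟨hxy.ne, fun h => G.loopless.irrefl _ h.1⟩
      rw [card_insert_of_notMem hx]
      have h1 := card_le_card (subset_insert y (C i))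
      have h2 := hCcard i hi
      have h3 : (#S + 1) * b ≤ 2 * r * b := Nat.mul_le_mul_right b hSr
      nlinarith
  · exfalso
    push Not at hcase
    have hfew : ∀ i ∈ S, ∀ u, G.Adj x u → (∃ v ∈ C i, v ≠ u ∧ ¬ G.Adj u v) →
        #{z ∈ C i | G.Adj u z} ≤ b := by
      rintro i hi u hu ⟨v, hv, hvu, huv⟩
      refine le_trans (card_le_card fun z hz => ?_)
        (P.card_common_inner_le hu ((memC _ _).1 hv).1 hvu.symm huv)
      rw [mem_filter] at hz
      simp only [mem_filter, mem_univ, true_and]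
      refine ⟨((memC _ _).1 hz.1).1, hz.2, hCclique i hi v hv z hz.1 ?_⟩
      rintro rfl
      exact huv hz.2
    have key : ∀ T ⊆ S, ∃ I : Finset V, IsClaw G x I ∧ #I = #T + 1 ∧
        ∀ u ∈ I, u = y ∨ ∃ i ∈ T, u ∈ C i := by
      intro T
      induction T using Finset.induction_on with
      | empty =>
        intro _
        exact ⟨{y}, by simp [IsClaw, hxy], by simp, by simp⟩
      | insert i T hiT ih =>
        intro hTS
        obtain ⟨I, hI, hIc, hIm⟩ := ih ((subset_insert _ _).trans hTS)
        have hi : i ∈ S := hTS (mem_insert_self _ _)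
        have hbad : ∀ u ∈ I, u ∉ C i ∧ #{z ∈ C i | G.Adj u z} ≤ b := by
          intro u hu
          rcases hIm u hu with rfl | ⟨j, hj, huj⟩
          · obtain ⟨v, hv, hvy, hyv⟩ := hcase i hi
            exact ⟨fun h => hyv (hCclique i hi u h v hv hvy.symm),
              hfew i hi u hxy ⟨v, hv, hvy, hyv⟩⟩
          · have hij : i ≠ j := fun h => hiT (h ▸ hj)
            have hjS := hTS (mem_insert_of_mem hj)
            have h1 := hCdisj i hi j hjS hij u huj
            refine ⟨fun h => ?_, hfew i hi u (hI.1 u hu) ⟨i, hCself i hi, h1.1.symm, h1.2⟩⟩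
            exact h1.2 ((hCclique i hi u h i (hCself i hi) h1.1))
        have hex : ∃ z ∈ C i, ∀ u ∈ I, ¬ G.Adj u z := by
          by_contra! hno
          have hsub : C i ⊆ I.biUnion fun u => {z ∈ C i | G.Adj u z} := by
            intro z hz
            obtain ⟨u, hu, huz⟩ := hno z hz
            exact mem_biUnion.2 ⟨u, hu, mem_filter.2 ⟨hz, huz⟩⟩
          have h1 := (card_le_card hsub).trans
            (card_biUnion_le_card_mul _ _ _ fun u hu => (hbad u hu).2)
          have h2 := hCcard i hi
          have h3 : #I ≤ 2 * r := by
            have := card_le_card hTS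
            rw [card_insert_of_notMem hiT] at this
            omega
          have h4 : #I * b ≤ 2 * r * b := Nat.mul_le_mul_right b h3
          have h5 : #S * b ≤ 2 * r * b := Nat.mul_le_mul_right b hSr.le
          nlinarith
        obtain ⟨z, hz, hzI⟩ := hex
        have hzn : z ∉ I := fun h => (hbad z h).1 hz
        refine ⟨insert z I, ⟨?_, ?_⟩, ?_, ?_⟩
        · intro u hu
          rcases mem_insert.1 hu with rfl | hu
          exacts [((memC _ _).1 hz).1, hI.1 u hu]
        · intro u hu v hv huv
          rcases mem_insert.1 hu with rfl | hu' <;> rcases mem_insert.1 hv with rfl | hv'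
          · exact (huv rfl).elim
          · exact fun h => hzI v hv' h.symm
          · exact hzI u hu'
          · exact hI.2 u hu' v hv' huv
        · rw [card_insert_of_notMem hzn, card_insert_of_notMem hiT, hIc]
        · intro u hu
          rcases mem_insert.1 hu with rfl | hu
          · exact Or.inr ⟨i, mem_insert_self _ _, hz⟩
          · rcases hIm u hu with h | ⟨j, hj, h⟩
            exacts [Or.inl h, Or.inr ⟨j, mem_insert_of_mem hj, h⟩]
    obtain ⟨I, hI, hIc, -⟩ := key S subset_rfl
    have := hmax I hI
    omega

end LocalParams

/-- A set of maximal cliques such that every edge lies in exactly one of them. -/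
structure IsLineSystem (G : SimpleGraph V) (L : Finset (Finset V)) : Prop where
  adj : ∀ ℓ ∈ L, ∀ x ∈ ℓ, ∀ y ∈ ℓ, x ≠ y → G.Adj x y
  cover : ∀ x y, G.Adj x y → ∃ ℓ ∈ L, x ∈ ℓ ∧ y ∈ ℓ
  unique : ∀ ℓ ∈ L, ∀ n ∈ L, ∀ x y, x ≠ y → x ∈ ℓ → y ∈ ℓ → x ∈ n → y ∈ n → ℓ = n
  maximal : ∀ ℓ ∈ L, ∀ x, x ∉ ℓ → ∃ v ∈ ℓ, ¬ G.Adj x v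

lemma LocalParams.clique_card_le (P : LocalParams G r b s) {C : Finset V}
    (hC : ∀ x ∈ C, ∀ y ∈ C, x ≠ y → G.Adj x y) {x y : V} (hx : x ∈ C) (hy : y ∈ C)
    (hne : x ≠ y) : #C ≤ s + 1 := by
  have hsub : C ⊆ insert x (insert y (univ.filter fun z => G.Adj x z ∧ G.Adj y z)) := by
    intro z hz
    simp only [mem_insert, mem_filter, mem_univ, true_and]
    by_cases h1 : z = x
    · exact Or.inl h1
    by_cases h2 : z = y
    · exact Or.inr (Or.inl h2)
    exact Or.inr (Or.inr ⟨hC x hx z hz (Ne.symm h1), hC y hy z hz (Ne.symm h2)⟩)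
  have h1 := card_le_card hsub
  have h2 := card_insert_le x (insert y (univ.filter fun z => G.Adj x z ∧ G.Adj y z))
  have h3 := card_insert_le y (univ.filter fun z => G.Adj x z ∧ G.Adj y z)
  have h4 := P.common_adj x y (hC x hx y hy hne)
  omega

/-- If `β` is large, then the large maximal cliques form a line system. -/
lemma LocalParams.exists_lineSystem (P : LocalParams G r b s) (hr : 1 ≤ r)
    (hs : 2 * r * (b + 1) ^ 2 ≤ s) :
    ∃ L, IsLineSystem G L ∧ ∀ ℓ ∈ L, s + 1 + 2 * b ≤ #ℓ + 2 * r * b := by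
  have mem_lines : ∀ C : Finset V, C ∈ (univ.filter fun C : Finset V =>
      G.IsClique C ∧ (∀ x, x ∉ C → ∃ v ∈ C, ¬ G.Adj x v) ∧
        s + 1 + 2 * b ≤ #C + 2 * r * b) ↔
      G.IsClique C ∧ (∀ x, x ∉ C → ∃ v ∈ C, ¬ G.Adj x v) ∧
        s + 1 + 2 * b ≤ #C + 2 * r * b := fun C => by
    rw [mem_filter]; simp only [mem_univ, true_and]
  refine ⟨univ.filter fun C : Finset V =>
      G.IsClique C ∧ (∀ x, x ∉ C → ∃ v ∈ C, ¬ G.Adj x v) ∧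
        s + 1 + 2 * b ≤ #C + 2 * r * b, ⟨?_, ?_, ?_, ?_⟩, fun ℓ hℓ => ((mem_lines ℓ).1 hℓ).2.2⟩
  · intro ℓ hℓ x hx y hy hne
    exact ((mem_lines ℓ).1 hℓ).1 (mem_coe.2 hx) (mem_coe.2 hy) hne
  · intro x y hxy
    obtain ⟨C, hC, hxC, hyC, hcard⟩ := P.exists_large_clique hr hs hxy
    obtain ⟨M, hM, hMmax⟩ := exists_max_image
      (univ.filter fun M : Finset V => G.IsClique M ∧ C ⊆ M) card
      ⟨C, mem_filter.2 ⟨mem_univ _, hC, subset_rfl⟩⟩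
    rw [mem_filter] at hM
    obtain ⟨-, hMc, hCM⟩ := hM
    refine ⟨M, (mem_lines M).2 ⟨hMc, ?_, ?_⟩, hCM hxC, hCM hyC⟩
    · intro z hz
      by_contra! hall
      have h := hMmax (insert z M) (mem_filter.2 ⟨mem_univ _, ?_, hCM.trans (subset_insert _ _)⟩)
      · rw [card_insert_of_notMem hz] at h
        omega
      · rw [coe_insert]
        exact hMc.insert fun v hv _ => hall v (mem_coe.1 hv)
    · have := card_le_card hCM
      omega
  · intro ℓ hℓ n hn x y hne hxℓ hyℓ hxn hyn
    rw [mem_lines] at hℓ hn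
    by_contra hln
    have hnot : ¬ ℓ ⊆ n := by
      intro hsub
      have : ∃ z ∈ n, z ∉ ℓ := by
        by_contra! h
        exact hln (subset_antisymm hsub h)
      obtain ⟨z, hzn, hzℓ⟩ := this
      obtain ⟨v, hv, hzv⟩ := hℓ.2.1 z hzℓ
      exact hzv (hn.1 (mem_coe.2 hzn) (mem_coe.2 (hsub hv)) fun h => hzℓ (h ▸ hv))
    obtain ⟨u, huℓ, hun⟩ := not_subset.1 hnot
    obtain ⟨w, hwn, huw⟩ := hn.2.1 u hun
    have hint : #(ℓ ∩ n) ≤ b + 1 := by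
      refine le_trans (card_le_card fun z hz => ?_)
        (P.card_common_le (x := u) (y := w) (fun h => hun (h ▸ hwn)) huw)
      rw [mem_inter] at hz
      rw [mem_filter]
      refine ⟨mem_univ _, hℓ.1 (mem_coe.2 huℓ) (mem_coe.2 hz.1) fun h => hun (h ▸ hz.2),
        hn.1 (mem_coe.2 hwn) (mem_coe.2 hz.2) ?_⟩
      rintro rfl
      exact huw (hℓ.1 (mem_coe.2 huℓ) (mem_coe.2 hz.1) fun h => hun (h ▸ hz.2))
    have hunion : #(ℓ ∪ n) ≤ s + 1 := by
      have hsub : ℓ ∪ n ⊆ insert x (insert y (univ.filter fun z => G.Adj x z ∧ G.Adj y z)) := by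
        intro z hz
        simp only [mem_insert, mem_filter, mem_univ, true_and]
        by_cases h1 : z = x
        · exact Or.inl h1
        by_cases h2 : z = y
        · exact Or.inr (Or.inl h2)
        refine Or.inr (Or.inr ?_)
        rcases mem_union.1 hz with h | h
        · exact ⟨hℓ.1 hxℓ h (Ne.symm h1), hℓ.1 hyℓ h (Ne.symm h2)⟩
        · exact ⟨hn.1 hxn h (Ne.symm h1), hn.1 hyn h (Ne.symm h2)⟩
      have h1 := card_le_card hsub
      have h2 := card_insert_le x (insert y (univ.filter fun z => G.Adj x z ∧ G.Adj y z))
      have h3 := card_insert_le y (univ.filter fun z => G.Adj x z ∧ G.Adj y z)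
      have h4 := P.common_adj x y (hℓ.1 hxℓ hyℓ hne)
      omega
    have := card_union_add_card_inter ℓ n
    have h1 := hℓ.2.2
    have h2 := hn.2.2
    nlinarith
  · intro ℓ hℓ
    exact ((mem_lines ℓ).1 hℓ).2.1

namespace IsLineSystem

variable {L : Finset (Finset V)}

lemma card_le (H : IsLineSystem G L) (P : LocalParams G r b s) {ℓ : Finset V} (hℓ : ℓ ∈ L) :
    #ℓ ≤ s + 1 := by
  by_cases h : #ℓ ≤ 1
  · omega
  · obtain ⟨x, hx, y, hy, hne⟩ := one_lt_card.1 (not_le.1 h)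
    exact P.clique_card_le (H.adj ℓ hℓ) hx hy hne

/-- The lines through `x` partition the neighbours of `x`. -/
lemma card_eq_sum_lines (H : IsLineSystem G L) {x : V} {S : Finset V}
    (hS : ∀ y ∈ S, G.Adj x y) : #S = ∑ ℓ ∈ L with x ∈ ℓ, #{y ∈ S | y ∈ ℓ} := by
  have h := sum_card_bipartiteAbove_eq_sum_card_bipartiteBelow
    (s := S) (t := {ℓ ∈ L | x ∈ ℓ}) (fun y ℓ => y ∈ ℓ)
  unfold bipartiteAbove bipartiteBelow at h
  rw [← h, card_eq_sum_ones]
  refine sum_congr rfl fun y hy => ?_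
  obtain ⟨ℓ, hℓ, hxℓ, hyℓ⟩ := H.cover x y (hS y hy)
  symm
  rw [card_eq_one]
  refine ⟨ℓ, eq_singleton_iff_unique_mem.2 ⟨by simp [hℓ, hxℓ, hyℓ], fun n hn => ?_⟩⟩
  simp only [mem_filter] at hn
  exact H.unique n hn.1.1 ℓ hℓ x y (hS y hy).ne hn.1.2 hn.2 hxℓ hyℓ

lemma filter_adj_eq_erase (H : IsLineSystem G L) {x : V} {ℓ : Finset V} (hℓ : ℓ ∈ L)
    (hx : x ∈ ℓ) : {y ∈ univ.filter fun z => G.Adj x z | y ∈ ℓ} = ℓ.erase x := by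
  ext y
  simp only [mem_filter, mem_univ, true_and, mem_erase]
  exact ⟨fun h => ⟨h.1.ne', h.2⟩, fun h => ⟨H.adj ℓ hℓ x hx y h.2 h.1.symm, h.2⟩⟩

lemma sum_card_lines (H : IsLineSystem G L) (P : LocalParams G r b s) (x : V) :
    ∑ ℓ ∈ L with x ∈ ℓ, (#ℓ - 1) = r * s := by
  rw [← P.deg x, H.card_eq_sum_lines (x := x) (S := univ.filter fun z => G.Adj x z) (by simp)]
  refine sum_congr rfl fun ℓ hℓ => ?_
  rw [mem_filter] at hℓ
  rw [H.filter_adj_eq_erase hℓ.1 hℓ.2, card_erase_of_mem hℓ.2]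

lemma le_card_lines_through (H : IsLineSystem G L) (P : LocalParams G r b s) (hs : 0 < s)
    (x : V) : r ≤ #{ℓ ∈ L | x ∈ ℓ} := by
  have h : r * s ≤ #{ℓ ∈ L | x ∈ ℓ} * s := by
    rw [← H.sum_card_lines P x]
    refine sum_le_card_nsmul _ _ _ fun ℓ hℓ => ?_
    have := H.card_le P (mem_filter.1 hℓ).1
    omega
  exact Nat.le_of_mul_le_mul_right h hs

/-- The lines are large. -/
def IsLarge (L : Finset (Finset V)) (r b s : ℕ) : Prop :=
  1 ≤ r ∧ 1 ≤ b ∧ 2 * r * (b + 1) ^ 2 ≤ s ∧ ∀ ℓ ∈ L, s + 1 + 2 * b ≤ #ℓ + 2 * r * b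

lemma card_lines_through_lt (H : IsLineSystem G L) (P : LocalParams G r b s)
    (hL : IsLarge L r b s) (x : V) : #{ℓ ∈ L | x ∈ ℓ} < 2 * r := by
  obtain ⟨hr, hb, hs, hsz⟩ := hL
  by_contra! hlt
  have h : #{ℓ ∈ L | x ∈ ℓ} * (s + 2 * b - 2 * r * b) ≤ r * s := by
    rw [← H.sum_card_lines P x]
    refine card_nsmul_le_sum _ _ _ fun ℓ hℓ => ?_
    have := hsz ℓ (mem_filter.1 hℓ).1
    omega
  have h1 : 2 * r * (s + 2 * b - 2 * r * b) ≤ r * s := (Nat.mul_le_mul_right _ hlt).trans h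
  have h2 : r * (2 * (s + 2 * b - 2 * r * b)) ≤ r * s := by linarith
  have h3 := Nat.le_of_mul_le_mul_left h2 hr
  have h4 : 2 * r * (2 * b) ≤ s := le_trans (by gcongr; nlinarith) hs
  have h5 : 2 * r * (2 * b) = 2 * (2 * r * b) := by ring
  omega

lemma dist_le_two_of_card (H : IsLineSystem G L) (P : LocalParams G r b s) {y : V}
    {ℓ : Finset V} (hℓ : ℓ ∈ L) (hc : b ^ 2 + b + 1 < #{v ∈ ℓ | G.dist y v ≤ 2}) :
    ∀ v ∈ ℓ, G.dist y v ≤ 2 := by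
  by_contra! hex
  obtain ⟨z, hz, hd⟩ := hex
  have hadj : ∀ v ∈ ({v ∈ ℓ | G.dist y v ≤ 2} : Finset V), G.Adj z v ∧ G.dist y z ≤ G.dist y v + 1
      ∧ G.dist y v ≤ 2 := by
    intro v hv
    rw [mem_filter] at hv
    have h : G.Adj z v := H.adj ℓ hℓ z hz v hv.1 (by rintro rfl; omega)
    have := P.conn.dist_triangle (u := y) (v := v) (w := z)
    rw [dist_eq_one_iff_adj.2 h.symm] at this
    exact ⟨h, this, hv.2⟩
  have hpos : 0 < #{v ∈ ℓ | G.dist y v ≤ 2} := by omega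
  obtain ⟨v, hv⟩ := card_pos.1 hpos
  have hv' := hadj v hv
  have h3 : G.dist y z = 3 := by omega
  have := card_le_card (s := {v ∈ ℓ | G.dist y v ≤ 2})
    (t := univ.filter fun v => G.Adj z v ∧ G.dist y v = 2) (fun v hv => by
      have := hadj v hv
      simp only [mem_filter, mem_univ, true_and]
      exact ⟨this.1, by omega⟩)
  rw [P.three_two y z h3] at this
  omega

lemma card_near (P : LocalParams G r b s) {x y : V} (hxy : G.dist x y = 2) :
    #{w | G.Adj x w ∧ G.dist y w ≤ 2} = (b + 1) * s := by
  have hsplit : (univ.filter fun w => G.Adj x w ∧ G.dist y w ≤ 2) =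
      (univ.filter fun w => G.Adj x w ∧ G.Adj y w) ∪
        univ.filter fun w => G.Adj x w ∧ G.dist y w = 2 := by
    ext w
    simp only [mem_union, mem_filter, mem_univ, true_and, ← and_or_left]
    refine and_congr_right fun hxw => ⟨fun h => ?_, ?_⟩
    · by_cases hyw : G.Adj y w
      · exact Or.inl hyw
      · refine Or.inr (P.dist_eq_two h ?_ hyw)
        rintro rfl
        rw [dist_eq_one_iff_adj.2 hxw] at hxy
        omega
    · rintro (h | h)
      · rw [dist_eq_one_iff_adj.2 h]; omega
      · omega
  rw [hsplit, card_union_of_disjoint, P.common_two x y hxy, add_comm,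
    P.two_two y x (by rwa [dist_comm])]
  rw [disjoint_filter]
  rintro w - h1 h2
  rw [dist_eq_one_iff_adj.2 h1.2] at h2
  omega

lemma card_block (H : IsLineSystem G L) (P : LocalParams G r b s)
    (hL : IsLarge L r b s) {x y : V} (hxy : G.dist x y = 2) :
    #{ℓ ∈ {ℓ ∈ L | x ∈ ℓ} | ∀ u ∈ ℓ, G.dist y u ≤ 2} = b + 1 := by
  have hlt := H.card_lines_through_lt P hL x
  obtain ⟨hr, hb, hs, hsz⟩ := hL
  have hsum := H.card_eq_sum_lines (x := x)
    (S := univ.filter fun w => G.Adj x w ∧ G.dist y w ≤ 2) (by simp +contextual)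
  rw [card_near P hxy, ← sum_filter_add_sum_filter_not _ (fun ℓ => ∀ u ∈ ℓ, G.dist y u ≤ 2)] at hsum
  set B : Finset (Finset V) := {ℓ ∈ {ℓ ∈ L | x ∈ ℓ} | ∀ u ∈ ℓ, G.dist y u ≤ 2} with hB
  set B' : Finset (Finset V) := {ℓ ∈ {ℓ ∈ L | x ∈ ℓ} | ¬ ∀ u ∈ ℓ, G.dist y u ≤ 2} with hB'
  have hin : ∀ ℓ ∈ B, #{w ∈ univ.filter fun w => G.Adj x w ∧ G.dist y w ≤ 2 | w ∈ ℓ} = #ℓ - 1 := by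
    intro ℓ hℓ
    simp only [hB, mem_filter] at hℓ
    rw [← card_erase_of_mem hℓ.1.2, ← H.filter_adj_eq_erase hℓ.1.1 hℓ.1.2]
    congr 1
    ext w
    simp only [mem_filter, mem_univ, true_and]
    exact ⟨fun h => ⟨h.1.1, h.2⟩, fun h => ⟨⟨h.1, hℓ.2 w h.2⟩, h.2⟩⟩
  have hout : ∀ ℓ ∈ B', #{w ∈ univ.filter fun w => G.Adj x w ∧ G.dist y w ≤ 2 | w ∈ ℓ} ≤
      b ^ 2 + b + 1 := by
    intro ℓ hℓ
    simp only [hB', mem_filter] at hℓ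
    by_contra! hc
    refine hℓ.2 (H.dist_le_two_of_card P hℓ.1.1 (hc.trans_le (card_le_card fun w hw => ?_)))
    simp only [mem_filter, mem_univ, true_and] at hw ⊢
    exact ⟨hw.2, hw.1.2⟩
  have h1 := sum_le_card_nsmul B' _ _ hout
  have h2 : ∑ ℓ ∈ B, #{w ∈ univ.filter fun w => G.Adj x w ∧ G.dist y w ≤ 2 | w ∈ ℓ} ≤ #B • s :=
    sum_le_card_nsmul _ _ _ fun ℓ hℓ => by
      rw [hin ℓ hℓ]
      have := H.card_le P (mem_filter.1 (mem_filter.1 hℓ).1).1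
      omega
  have h3 : #B • (s + 2 * b - 2 * r * b) ≤
      ∑ ℓ ∈ B, #{w ∈ univ.filter fun w => G.Adj x w ∧ G.dist y w ≤ 2 | w ∈ ℓ} :=
    card_nsmul_le_sum _ _ _ fun ℓ hℓ => by
      rw [hin ℓ hℓ]
      have := hsz ℓ (mem_filter.1 (mem_filter.1 hℓ).1).1
      omega
  have h4 : #B' ≤ 2 * r := (card_le_card (filter_subset _ _)).trans hlt.le
  have h5 : #B' * (b ^ 2 + b + 1) ≤ 2 * r * (b ^ 2 + b + 1) := Nat.mul_le_mul_right _ h4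
  have hrb : 0 < r * b := Nat.mul_pos hr hb
  rw [smul_eq_mul] at h1 h2 h3
  apply le_antisymm
  · by_contra! hgt
    have h6 : (b + 2) * (s + 2 * b - 2 * r * b) ≤ (b + 1) * s :=
      (Nat.mul_le_mul_right _ hgt).trans (by omega)
    have h7 : s + 2 * b ≤ (s + 2 * b - 2 * r * b) + 2 * r * b := by omega
    nlinarith [Nat.mul_le_mul_left (b + 2) h7]
  · by_contra! hlt'
    have h6 : #B * s ≤ b * s := Nat.mul_le_mul_right _ (by omega)
    nlinarith

lemma card_parallel_block (H : IsLineSystem G L) (P : LocalParams G r b s)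
    (hL : IsLarge L r b s) {z : V} {ℓ : Finset V} (hℓ : ℓ ∈ L) (hz : z ∉ ℓ)
    (hd : ∀ v ∈ ℓ, G.dist z v ≤ 2) :
    #{n ∈ {n ∈ L | z ∈ n} | ∀ w ∈ n, ∀ v ∈ ℓ, G.dist v w ≤ 2} = b + 1 := by
  obtain ⟨v₀, hv₀, hna⟩ := H.maximal ℓ hℓ z hz
  have hne : ∀ v ∈ ℓ, z ≠ v := fun v hv h => hz (h ▸ hv)
  have hd₀ := P.dist_eq_two (hd v₀ hv₀) (hne v₀ hv₀) hna
  have hlt := H.card_lines_through_lt P hL z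
  set A : Finset (Finset V) := {n ∈ {n ∈ L | z ∈ n} | ∀ w ∈ n, ∀ v ∈ ℓ, G.dist v w ≤ 2} with hA
  apply le_antisymm
  · rw [← H.card_block P hL hd₀]
    refine card_le_card fun n hn => ?_
    rw [hA, mem_filter] at hn
    exact mem_filter.2 ⟨hn.1, fun u hu => hn.2 u hu v₀ hv₀⟩
  · by_contra! hAlt
    set F : Finset V := {v ∈ ℓ | G.dist z v = 2} with hF
    have hFc : #ℓ ≤ #F + (b + 1) := by
      rw [← P.common_two z v₀ hd₀]
      refine (card_le_card fun v hv => ?_).trans (card_union_le _ _)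
      simp only [hF, mem_union, mem_filter, mem_univ, true_and]
      by_cases hzv : G.Adj z v
      · exact Or.inr ⟨hzv, H.adj ℓ hℓ v₀ hv₀ v hv (by rintro rfl; exact hna hzv)⟩
      · exact Or.inl ⟨hv, P.dist_eq_two (hd v hv) (hne v hv) hzv⟩
    have hdc := sum_card_bipartiteAbove_eq_sum_card_bipartiteBelow
      (s := F) (t := {n ∈ L | z ∈ n}) (fun v n => ∀ w ∈ n, G.dist v w ≤ 2)
    unfold bipartiteAbove bipartiteBelow at hdc
    rw [sum_congr rfl fun v hv => H.card_block P hL (mem_filter.1 hv).2, sum_const, smul_eq_mul,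
      ← sum_filter_add_sum_filter_not _ (fun n => ∀ w ∈ n, ∀ v ∈ ℓ, G.dist v w ≤ 2)] at hdc
    have h1 : ∑ n ∈ A, #{v ∈ F | ∀ w ∈ n, G.dist v w ≤ 2} ≤ #A • #F :=
      sum_le_card_nsmul _ _ _ fun n _ => card_le_card (filter_subset _ _)
    have h2 : ∑ n ∈ {n ∈ {n ∈ L | z ∈ n} | ¬ ∀ w ∈ n, ∀ v ∈ ℓ, G.dist v w ≤ 2},
        #{v ∈ F | ∀ w ∈ n, G.dist v w ≤ 2} ≤
        #{n ∈ {n ∈ L | z ∈ n} | ¬ ∀ w ∈ n, ∀ v ∈ ℓ, G.dist v w ≤ 2} • (b ^ 2 + b + 1) := by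
      refine sum_le_card_nsmul _ _ _ fun n hn => ?_
      by_contra! hc
      refine (mem_filter.1 hn).2 fun w hw v hv => ?_
      rw [dist_comm]
      refine H.dist_le_two_of_card P hℓ (hc.trans_le (card_le_card fun v hv => ?_)) v hv
      simp only [hF, mem_filter] at hv ⊢
      exact ⟨hv.1.1, by rw [dist_comm]; exact hv.2 w hw⟩
    rw [smul_eq_mul] at h1 h2
    have h3 : #{n ∈ {n ∈ L | z ∈ n} | ¬ ∀ w ∈ n, ∀ v ∈ ℓ, G.dist v w ≤ 2} + 1 ≤ 2 * r :=
      Nat.lt_of_le_of_lt (card_le_card (filter_subset _ _)) hlt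
    have h4 := Nat.mul_le_mul_right (b ^ 2 + b + 1) h3
    have h5 : #A * #F ≤ b * #F := Nat.mul_le_mul_right _ (by omega)
    obtain ⟨hr, hb, hs, hsz⟩ := hL
    have h6 := hsz ℓ hℓ
    have h7 : #F + (b ^ 2 + b + 1) ≤ 2 * r * (b ^ 2 + b + 1) := by
      have hdc' : #F * (b + 1) = ∑ n ∈ A, #{v ∈ F | ∀ w ∈ n, G.dist v w ≤ 2} +
          ∑ n ∈ {n ∈ {n ∈ L | z ∈ n} | ¬ ∀ w ∈ n, ∀ v ∈ ℓ, G.dist v w ≤ 2},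
            #{v ∈ F | ∀ w ∈ n, G.dist v w ≤ 2} := hdc
      linarith
    nlinarith

/-- The number of lines through a vertex is constant. -/
lemma card_lines_through_adj (H : IsLineSystem G L) (P : LocalParams G r b s)
    (hL : IsLarge L r b s) {x u : V} (hxu : G.Adj x u) :
    #{ℓ ∈ L | x ∈ ℓ} = #{n ∈ L | u ∈ n} := by
  obtain ⟨ℓ₀, hℓ₀, hx₀, hu₀⟩ := H.cover x u hxu
  have key : ∀ x u, G.Adj x u → x ∈ ℓ₀ → u ∈ ℓ₀ → ∀ ℓ ∈ ({ℓ ∈ L | x ∈ ℓ} : Finset _).erase ℓ₀,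
      #{n ∈ ({n ∈ L | u ∈ n} : Finset _).erase ℓ₀ | ∀ w ∈ n, ∀ v ∈ ℓ, G.dist v w ≤ 2} = b := by
    intro x u hxu hx₀ hu₀ ℓ hℓ
    simp only [mem_erase, mem_filter] at hℓ
    obtain ⟨hne, hℓL, hxℓ⟩ := hℓ
    have hu : u ∉ ℓ := fun h => hne (H.unique ℓ hℓL ℓ₀ hℓ₀ x u hxu.ne hxℓ h hx₀ hu₀)
    have hd : ∀ w, (w = x ∨ G.Adj x w) → ∀ v ∈ ℓ, G.dist v w ≤ 2 := by
      intro w hw v hv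
      by_cases hvx : v = x
      · subst hvx
        rcases hw with rfl | hw
        · simp
        · rw [dist_eq_one_iff_adj.2 hw]; omega
      · have hxv := H.adj ℓ hℓL v hv x hxℓ hvx
        rcases hw with rfl | hw
        · rw [dist_eq_one_iff_adj.2 hxv]; omega
        · exact P.dist_le_two hxv hw
    have h := H.card_parallel_block P hL hℓL hu fun v hv => by
      rw [dist_comm]; exact hd u (Or.inr hxu) v hv
    rw [filter_erase, card_erase_of_mem, h]
    · omega
    · simp only [mem_filter]
      refine ⟨⟨hℓ₀, hu₀⟩, fun w hw v hv => hd w ?_ v hv⟩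
      by_cases hwx : w = x
      · exact Or.inl hwx
      · exact Or.inr (H.adj ℓ₀ hℓ₀ x hx₀ w hw (Ne.symm hwx))
  have hdc := sum_card_bipartiteAbove_eq_sum_card_bipartiteBelow
    (s := ({ℓ ∈ L | x ∈ ℓ} : Finset _).erase ℓ₀) (t := ({n ∈ L | u ∈ n} : Finset _).erase ℓ₀)
    (fun ℓ n => ∀ w ∈ n, ∀ v ∈ ℓ, G.dist v w ≤ 2)
  unfold bipartiteAbove bipartiteBelow at hdc
  rw [sum_congr rfl (key x u hxu hx₀ hu₀)] at hdc
  have hsymm : ∀ n ∈ ({n ∈ L | u ∈ n} : Finset _).erase ℓ₀,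
      #{ℓ ∈ ({ℓ ∈ L | x ∈ ℓ} : Finset _).erase ℓ₀ | ∀ w ∈ n, ∀ v ∈ ℓ, G.dist v w ≤ 2} = b := by
    intro n hn
    rw [← key u x hxu.symm hu₀ hx₀ n hn]
    congr 1
    refine filter_congr fun ℓ _ => ⟨fun h w hw v hv => ?_, fun h w hw v hv => ?_⟩
    · rw [dist_comm]; exact h v hv w hw
    · rw [dist_comm]; exact h v hv w hw
  rw [sum_congr rfl hsymm, sum_const, sum_const, smul_eq_mul, smul_eq_mul] at hdc
  have h1 := Nat.eq_of_mul_eq_mul_right (by have := hL.2.1; omega) hdc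
  have h2 := card_erase_add_one (s := {ℓ ∈ L | x ∈ ℓ}) (a := ℓ₀) (by simp [hℓ₀, hx₀])
  have h3 := card_erase_add_one (s := {ℓ ∈ L | u ∈ ℓ}) (a := ℓ₀) (by simp [hℓ₀, hu₀])
  omega

lemma card_lines_through_eq (H : IsLineSystem G L) (P : LocalParams G r b s)
    (hL : IsLarge L r b s) (x y : V) : #{ℓ ∈ L | x ∈ ℓ} = #{ℓ ∈ L | y ∈ ℓ} := by
  obtain ⟨p⟩ := P.conn.preconnected x y
  induction p with
  | nil => rfl
  | cons h _ ih => exact (H.card_lines_through_adj P hL h).trans ih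

lemma card_lines_lt (H : IsLineSystem G L) (P : LocalParams G r b s)
    (hL : IsLarge L r b s) : #L < Fintype.card V := by
  have hdc := sum_card_bipartiteAbove_eq_sum_card_bipartiteBelow
    (s := (univ : Finset V)) (t := L) (fun x ℓ => x ∈ ℓ)
  unfold bipartiteAbove bipartiteBelow at hdc
  have : Nonempty V := P.conn.nonempty
  have h1 : ∑ x : V, #{ℓ ∈ L | x ∈ ℓ} < ∑ _x : V, 2 * r :=
    sum_lt_sum_of_nonempty univ_nonempty fun x _ => H.card_lines_through_lt P hL x
  obtain ⟨hr, hb, hs, hsz⟩ := hL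
  have h2 : #L • (2 * r) ≤ ∑ ℓ ∈ L, #{x | x ∈ ℓ} :=
    card_nsmul_le_sum _ _ _ fun ℓ hℓ => by
      have := hsz ℓ hℓ
      rw [filter_mem_eq_inter, univ_inter]
      nlinarith
  rw [sum_const, smul_eq_mul, card_univ] at h1
  rw [smul_eq_mul, ← hdc] at h2
  exact lt_of_mul_lt_mul_right (h2.trans_lt h1) (Nat.zero_le _)

end IsLineSystem

lemma gauss_succ (b j : ℕ) : gauss b (j + 1) = gauss b j + (b : ℝ) ^ j := by
  simp [gauss, sum_range_succ]

lemma gauss_zero (b : ℕ) : gauss b 0 = 0 := by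
  simp [gauss]

lemma gauss_one (b : ℕ) : gauss b 1 = 1 := by
  simp [gauss]

lemma gauss_mono (b : ℕ) : Monotone (gauss b) :=
  monotone_nat_of_le_succ fun j => by
    rw [gauss_succ]
    have : (0 : ℝ) ≤ (b : ℝ) ^ j := by positivity
    linarith

lemma gauss_succ_pos (b j : ℕ) : 0 < gauss b (j + 1) := by
  have h := gauss_mono b (Nat.le_add_left 1 j)
  rw [gauss_one] at h
  linarith

/-- The intersection numbers of a distance-regular graph with classical parameters
`(D, b, 0, β)`. -/
structure IsClassical (G : SimpleGraph V) (D b : ℕ) (β : ℝ) : Prop where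
  conn : G.Connected
  dist_le : ∀ x y, G.dist x y ≤ D
  exists_dist : ∃ x y, G.dist x y = D
  lower : ∀ i x y, G.dist x y = i + 1 →
    (#{z | G.Adj y z ∧ G.dist x z = i} : ℝ) = gauss b (i + 1)
  same : ∀ i x y, G.dist x y = i →
    (#{z | G.Adj y z ∧ G.dist x z = i} : ℝ) = gauss b i * (β - 1)
  upper : ∀ i x y, G.dist x y = i →
    (#{z | G.Adj y z ∧ G.dist x z = i + 1} : ℝ) = (gauss b D - gauss b i) * β

/-- The sum of `f` over the sphere of radius `i` around `x`. -/
noncomputable def sphereSum (G : SimpleGraph V) (f : V → ℝ) (x : V) (i : ℕ) : ℝ :=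
  ∑ y with G.dist x y = i, f y

namespace IsClassical

variable {D : ℕ} {β : ℝ} {f : V → ℝ}

lemma sphereSum_zero (C : IsClassical G D b β) (x : V) : sphereSum G f x 0 = f x := by
  have h : (univ.filter fun y => G.dist x y = 0) = {x} := by
    ext y
    simp [C.conn.dist_eq_zero_iff, eq_comm]
  rw [sphereSum, h, sum_singleton]

lemma sphereSum_eq_zero (C : IsClassical G D b β) (x : V) {i : ℕ} (hi : D < i) :
    sphereSum G f x i = 0 := by
  rw [sphereSum, filter_eq_empty_iff.2, sum_empty]
  intro y _ h
  have := C.dist_le x y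
  omega

lemma sum_sphere_adj (C : IsClassical G D b β) (x : V) (i : ℕ) :
    ∑ y with G.dist x y = i + 1, ∑ z with G.Adj y z, f z =
      (gauss b D - gauss b i) * β * sphereSum G f x i +
        gauss b (i + 1) * (β - 1) * sphereSum G f x (i + 1) +
        gauss b (i + 2) * sphereSum G f x (i + 2) := by
  have hswap : ∑ y with G.dist x y = i + 1, ∑ z with G.Adj y z, f z =
      ∑ z, (#{y | G.Adj z y ∧ G.dist x y = i + 1} : ℝ) * f z := by
    rw [sum_comm' (t' := univ) (s' := fun z => univ.filter fun y => G.Adj z y ∧ G.dist x y = i + 1)]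
    · simp
    · intro y z
      simp [G.adj_comm, and_comm]
  rw [hswap]
  simp only [sphereSum, sum_filter, mul_sum, ← sum_add_distrib]
  refine sum_congr rfl fun z _ => ?_
  by_cases h0 : G.dist x z = i
  · rw [C.upper i x z h0]
    simp [h0]
  by_cases h1 : G.dist x z = i + 1
  · rw [C.same (i + 1) x z h1]
    simp [h1]
  by_cases h2 : G.dist x z = i + 2
  · rw [C.lower (i + 1) x z h2]
    simp [h2]
  have hempty : (univ.filter fun y => G.Adj z y ∧ G.dist x y = i + 1) = ∅ := by
    rw [filter_eq_empty_iff]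
    rintro y - ⟨hzy, hy⟩
    have h3 := C.conn.dist_triangle (u := x) (v := z) (w := y)
    have h4 := C.conn.dist_triangle (u := x) (v := y) (w := z)
    rw [dist_eq_one_iff_adj.2 hzy] at h3
    rw [dist_eq_one_iff_adj.2 hzy.symm] at h4
    omega
  rw [hempty]
  simp [h0, h1, h2]

/-- The smallest eigenvalue of the graph is at least `-[D]`. -/
lemma le_gauss_of_eigenvector (C : IsClassical G D b β) (hβ : 0 ≤ β) {m : ℝ} (hf : f ≠ 0)
    (hm : ∀ x, ∑ y with G.Adj x y, f y = -m * f x) : m ≤ gauss b D := by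
  wlog hpos : ∃ x, 0 < f x generalizing f with key
  · obtain ⟨x, hx⟩ := Function.ne_iff.1 hf
    refine key (f := -f) (by simpa using hf) (fun y => ?_) ⟨x, ?_⟩
    · simp only [Pi.neg_apply, sum_neg_distrib, hm y]
      ring
    · push Not at hpos
      have := hpos x
      simp only [Pi.zero_apply] at hx
      simp only [Pi.neg_apply, Left.neg_pos_iff]
      exact lt_of_le_of_ne this hx
  obtain ⟨x, hx⟩ := hpos
  by_contra! hlt
  set g : ℕ → ℝ := fun i => (-1) ^ i * sphereSum G f x i with hg
  have hg0 : g 0 = f x := by simp [hg, C.sphereSum_zero]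
  have hg1 : g 1 = m * f x := by
    have h : (univ.filter fun y => G.dist x y = 1) = univ.filter fun y => G.Adj x y := by
      ext y; simp [dist_eq_one_iff_adj]
    simp only [hg, sphereSum, h, hm]
    ring
  have hrec : ∀ i, gauss b (i + 2) * g (i + 2) =
      (m + gauss b (i + 1) * (β - 1)) * g (i + 1) - (gauss b D - gauss b i) * β * g i := by
    intro i
    have h := C.sum_sphere_adj (f := f) x i
    simp only [hm, ← mul_sum] at h
    change -m * sphereSum G f x (i + 1) = _ at h
    simp only [hg, pow_succ]
    linear_combination -(-1) ^ i * h
  have hpos : ∀ i ≤ D, 0 < g i ∧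
      0 < gauss b (i + 1) * g (i + 1) - (gauss b D - gauss b i) * g i := by
    intro i
    induction i with
    | zero =>
      intro _
      rw [gauss_one, gauss_zero, zero_add, hg0, hg1]
      exact ⟨hx, by nlinarith⟩
    | succ i ih =>
      intro hi
      obtain ⟨h1, h2⟩ := ih (by omega)
      have h3 := gauss_mono b (show i ≤ D by omega)
      have h4 : 0 < gauss b (i + 1) * g (i + 1) := by nlinarith
      have h5 : 0 < g (i + 1) := (mul_pos_iff_of_pos_left (gauss_succ_pos b i)).1 h4
      refine ⟨h5, ?_⟩
      have h6 := hrec i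
      have h7 : gauss b (i + 1 + 1) * g (i + 1 + 1) - (gauss b D - gauss b (i + 1)) * g (i + 1) =
          (m - gauss b D) * g (i + 1) +
            β * (gauss b (i + 1) * g (i + 1) - (gauss b D - gauss b i) * g i) := by
        linear_combination h6
      rw [h7]
      have := mul_pos (sub_pos.2 hlt) h5
      have := mul_nonneg hβ h2.le
      linarith
  have h := (hpos D le_rfl).2
  simp [hg, C.sphereSum_eq_zero x (Nat.lt_succ_self D)] at h

end IsClassical

namespace IsLineSystem

variable {L : Finset (Finset V)} {D : ℕ} {β : ℝ}

lemma exists_sum_line_eq_zero (hL : #L < Fintype.card V) :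
    ∃ f : V → ℝ, f ≠ 0 ∧ ∀ ℓ ∈ L, ∑ x ∈ ℓ, f x = 0 := by
  let T : (V → ℝ) →ₗ[ℝ] (L → ℝ) :=
    LinearMap.pi fun ℓ => ∑ x ∈ ℓ.1, LinearMap.proj x
  have h : LinearMap.ker T ≠ ⊥ := LinearMap.ker_ne_bot_of_finrank_lt (by simpa using hL)
  obtain ⟨f, hf, hf0⟩ := Submodule.exists_mem_ne_zero_of_ne_bot h
  refine ⟨f, hf0, fun ℓ hℓ => ?_⟩
  have := congrFun (LinearMap.mem_ker.1 hf) ⟨ℓ, hℓ⟩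
  simpa [T] using this

lemma sum_adj_eq (H : IsLineSystem G L) {f : V → ℝ} (hf : ∀ ℓ ∈ L, ∑ x ∈ ℓ, f x = 0) (x : V) :
    ∑ y with G.Adj x y, f y = -(#{ℓ ∈ L | x ∈ ℓ} : ℝ) * f x := by
  have h1 : ∑ ℓ ∈ L with x ∈ ℓ, ∑ y ∈ ℓ.erase x, f y = -(#{ℓ ∈ L | x ∈ ℓ} : ℝ) * f x := by
    rw [sum_congr rfl (g := fun _ => -f x), sum_const, nsmul_eq_mul]
    · ring
    · intro ℓ hℓ
      rw [mem_filter] at hℓ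
      have := add_sum_erase ℓ f hℓ.2
      rw [hf ℓ hℓ.1] at this
      linarith
  rw [← h1, sum_comm' (t' := univ.filter fun y => G.Adj x y)
    (s' := fun y => {ℓ ∈ {ℓ ∈ L | x ∈ ℓ} | y ∈ ℓ})]
  · refine sum_congr rfl fun y hy => ?_
    have hxy : G.Adj x y := by simpa using hy
    obtain ⟨ℓ, hℓ, hxℓ, hyℓ⟩ := H.cover x y hxy
    have : ({ℓ ∈ {ℓ ∈ L | x ∈ ℓ} | y ∈ ℓ} : Finset _) = {ℓ} := by
      refine eq_singleton_iff_unique_mem.2 ⟨by simp [hℓ, hxℓ, hyℓ], fun n hn => ?_⟩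
      simp only [mem_filter] at hn
      exact H.unique n hn.1.1 ℓ hℓ x y hxy.ne hn.1.2 hn.2 hxℓ hyℓ
    rw [this, sum_singleton]
  · intro ℓ y
    simp only [mem_filter, mem_univ, true_and, mem_erase]
    constructor
    · rintro ⟨⟨hℓ, hx⟩, hne, hy⟩
      exact ⟨⟨⟨hℓ, hx⟩, hy⟩, H.adj ℓ hℓ x hx y hy hne.symm⟩
    · rintro ⟨⟨⟨hℓ, hx⟩, hy⟩, hxy⟩
      exact ⟨⟨hℓ, hx⟩, hxy.ne', hy⟩

lemma card_lines_through (H : IsLineSystem G L) (P : LocalParams G r b s)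
    (hL : IsLarge L r b s) (C : IsClassical G D b s) (hr : gauss b D = r) (x : V) :
    #{ℓ ∈ L | x ∈ ℓ} = r := by
  refine le_antisymm ?_ (H.le_card_lines_through P ?_ x)
  · obtain ⟨f, hf, hsum⟩ := exists_sum_line_eq_zero (H.card_lines_lt P hL)
    have h := C.le_gauss_of_eigenvector (Nat.cast_nonneg s) (m := (#{ℓ ∈ L | x ∈ ℓ} : ℝ)) hf
      fun y => by rw [H.sum_adj_eq hsum, H.card_lines_through_eq P hL x y]
    rw [hr] at h
    exact_mod_cast h
  · obtain ⟨hr, hb, hs, -⟩ := hL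
    exact lt_of_lt_of_le (by positivity) hs

lemma card_line (H : IsLineSystem G L) (P : LocalParams G r b s)
    (hL : IsLarge L r b s) (C : IsClassical G D b s) (hr : gauss b D = r) {ℓ : Finset V}
    (hℓ : ℓ ∈ L) : #ℓ = s + 1 := by
  have hpos : 0 < #ℓ := by
    obtain ⟨h1, h2, h3, h4⟩ := hL
    have := h4 ℓ hℓ
    nlinarith
  obtain ⟨x, hx⟩ := card_pos.1 hpos
  have h1 := H.sum_card_lines P x
  have h2 := H.card_lines_through P hL C hr x
  have hle : ∀ n ∈ ({ℓ ∈ L | x ∈ ℓ} : Finset _), #n - 1 ≤ s := fun n hn => by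
    have := H.card_le P (mem_filter.1 hn).1
    omega
  have h3 : ∑ n ∈ L with x ∈ n, (#n - 1) = ∑ n ∈ L with x ∈ n, s := by
    rw [h1, sum_const, h2, smul_eq_mul]
  have h4 := (sum_eq_sum_iff_of_le hle).1 h3 ℓ (by simp [hℓ, hx])
  omega

end IsLineSystem

/-- A line system all of whose lines have `s + 1` points, with `s > b ^ 2`. -/
structure IsGeometry (G : SimpleGraph V) (L : Finset (Finset V)) (r b s : ℕ) : Prop where
  lines : IsLineSystem G L
  params : LocalParams G r b s
  card_line : ∀ ℓ ∈ L, #ℓ = s + 1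
  two_le : 2 ≤ b
  sq_lt : b ^ 2 < s

/-- The lines `ℓ` and `m` are disjoint and every point of `ℓ` has a neighbour on `m`. -/
def IsOpposite (G : SimpleGraph V) (ℓ m : Finset V) : Prop :=
  Disjoint ℓ m ∧ ∀ p ∈ ℓ, ∃ c ∈ m, G.Adj p c

/-- The line `t` meets both `ℓ` and `m`. -/
def IsTransversal (ℓ m t : Finset V) : Prop :=
  (∃ a ∈ ℓ, a ∈ t) ∧ ∃ c ∈ m, c ∈ t

namespace IsGeometry

variable {L : Finset (Finset V)} {ℓ m n t t' : Finset V} {x y z u v p q a a' c c' : V}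

lemma dist_le_two_of_mem (Γ : IsGeometry G L r b s) (hℓ : ℓ ∈ L) (hu : u ∈ ℓ) (hv : v ∈ ℓ)
    (hz : G.Adj z u) : G.dist z v ≤ 2 := by
  by_cases huv : u = v
  · subst huv
    rw [dist_eq_one_iff_adj.2 hz]; omega
  · exact Γ.params.dist_le_two hz (Γ.lines.adj ℓ hℓ u hu v hv huv)

lemma neighbour_unique (Γ : IsGeometry G L r b s) (hℓ : ℓ ∈ L) (hz : z ∉ ℓ) (hu : u ∈ ℓ)
    (hv : v ∈ ℓ) (hzu : G.Adj z u) (hzv : G.Adj z v) : u = v := by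
  by_contra huv
  have h1 : insert z ((ℓ.erase u).erase v) ⊆ univ.filter fun w => G.Adj u w ∧ G.Adj v w := by
    intro w hw
    simp only [mem_insert, mem_erase, mem_filter, mem_univ, true_and] at hw ⊢
    rcases hw with rfl | ⟨h1, h2, h3⟩
    · exact ⟨hzu.symm, hzv.symm⟩
    · exact ⟨Γ.lines.adj ℓ hℓ u hu w h3 (Ne.symm h2), Γ.lines.adj ℓ hℓ v hv w h3 (Ne.symm h1)⟩
  have h2 := card_le_card h1
  have h3 := Γ.params.common_adj u v (Γ.lines.adj ℓ hℓ u hu v hv huv)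
  rw [card_insert_of_notMem (by simp [hz]), card_erase_of_mem (by simp [hv, Ne.symm huv]),
    card_erase_of_mem hu, Γ.card_line ℓ hℓ] at h2
  omega

/-- A point at distance at most two from two points of a line is on the line or has a neighbour
on it. -/
lemma mem_or_exists_adj (Γ : IsGeometry G L r b s) (hn : n ∈ L) (hu : u ∈ n) (hv : v ∈ n)
    (huv : u ≠ v) (hzu : G.dist z u ≤ 2) (hzv : G.dist z v ≤ 2) :
    z ∈ n ∨ ∃ w ∈ n, G.Adj z w := by
  by_contra! hcon
  obtain ⟨hz, hna⟩ := hcon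
  have hd : G.dist z u = 2 :=
    Γ.params.dist_eq_two hzu (fun h => hz (h ▸ hu)) (hna u hu)
  have hd' : G.dist z v = 2 :=
    Γ.params.dist_eq_two hzv (fun h => hz (h ▸ hv)) (hna v hv)
  choose! line hline using Γ.lines.cover
  set W : Finset V := {w | G.Adj z w ∧ G.Adj u w} with hW
  have memW : ∀ w ∈ W, G.Adj z w ∧ G.Adj u w := fun w hw => by simpa [hW] using hw
  have hzline : ∀ w ∈ W, z ∉ line u w := by
    intro w hw hzw
    obtain ⟨h1, h2, -⟩ := hline u w (memW w hw).2
    exact hna u hu (Γ.lines.adj _ h1 z hzw u h2 fun h => hz (h ▸ hu))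
  have hsub : W.biUnion (fun w => ((line u w).erase u).erase w) ⊆
      univ.filter fun v => G.Adj u v ∧ G.dist z v = 2 := by
    intro p hp
    simp only [mem_biUnion, mem_erase, mem_filter, mem_univ, true_and] at hp ⊢
    obtain ⟨w, hw, hpw, hpu, hpl⟩ := hp
    obtain ⟨h1, h2, h3⟩ := hline u w (memW w hw).2
    refine ⟨Γ.lines.adj _ h1 u h2 p hpl (Ne.symm hpu), Γ.params.dist_eq_two
      (Γ.dist_le_two_of_mem h1 h3 hpl (memW w hw).1) ?_ ?_⟩
    · rintro rfl
      exact hzline w hw hpl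
    · intro h
      exact hpw (Γ.neighbour_unique h1 (hzline w hw) hpl h3 h (memW w hw).1)
  have hcard : #(W.biUnion fun w => ((line u w).erase u).erase w) = (b + 1) * (s - 1) := by
    rw [card_biUnion, sum_congr rfl (g := fun _ => s - 1), sum_const, smul_eq_mul, hW,
      Γ.params.common_two z u hd]
    · intro w hw
      obtain ⟨h1, h2, h3⟩ := hline u w (memW w hw).2
      rw [card_erase_of_mem (by simp [h3, (memW w hw).2.ne']), card_erase_of_mem h2,
        Γ.card_line _ h1]
      omega
    · intro w hw w' hw' hne
      rw [Function.onFun, Finset.disjoint_left]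
      intro p hp hp'
      simp only [mem_erase] at hp hp'
      obtain ⟨h1, h2, h3⟩ := hline u w (memW w hw).2
      obtain ⟨h1', h2', h3'⟩ := hline u w' (memW w' hw').2
      have heq := Γ.lines.unique _ h1 _ h1' p u hp.2.1 hp.2.2 h2 hp'.2.2 h2'
      rw [← heq] at h3'
      exact hne (Γ.neighbour_unique h1 (hzline w hw) h3 h3' (memW w hw).1 (memW w' hw').1)
  have htwo := Γ.params.two_two z u hd
  have heq := eq_of_subset_of_card_le hsub (by
    have h1 : 1 ≤ s := by have := Γ.sq_lt; omega
    obtain ⟨s', rfl⟩ := Nat.exists_eq_add_of_le h1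
    rw [hcard, Nat.add_sub_cancel_left]
    nlinarith)
  have hv' : v ∈ univ.filter fun v => G.Adj u v ∧ G.dist z v = 2 := by
    simp [hd', Γ.lines.adj n hn u hu v hv huv]
  rw [← heq] at hv'
  simp only [mem_biUnion, mem_erase] at hv'
  obtain ⟨w, hw, -, -, hvl⟩ := hv'
  obtain ⟨h1, h2, h3⟩ := hline u w (memW w hw).2
  have := Γ.lines.unique _ h1 _ hn u v huv h2 hvl hu hv
  exact hna w (this ▸ h3) (memW w hw).1

lemma dist_line_le_two (Γ : IsGeometry G L r b s) (hn : n ∈ L) (hu : u ∈ n) (hv : v ∈ n)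
    (huv : u ≠ v) (hzu : G.dist z u ≤ 2) (hzv : G.dist z v ≤ 2) (hp : p ∈ n) :
    G.dist z p ≤ 2 := by
  rcases Γ.mem_or_exists_adj hn hu hv huv hzu hzv with h | ⟨w, hw, hzw⟩
  · by_cases hzp : z = p
    · simp [hzp]
    · rw [dist_eq_one_iff_adj.2 (Γ.lines.adj n hn z h p hp hzp)]; omega
  · exact Γ.dist_le_two_of_mem hn hw hp hzw

lemma dist_le_two_of_opposite (Γ : IsGeometry G L r b s) (hm : m ∈ L)
    (h : IsOpposite G ℓ m) (hp : p ∈ ℓ) (hc : c ∈ m) : G.dist p c ≤ 2 := by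
  obtain ⟨c', hc', hpc⟩ := h.2 p hp
  exact Γ.dist_le_two_of_mem hm hc' hc hpc

lemma one_lt_card_line (Γ : IsGeometry G L r b s) (hℓ : ℓ ∈ L) : 1 < #ℓ := by
  have := Γ.sq_lt
  rw [Γ.card_line ℓ hℓ]
  omega

lemma opposite_of_dist (Γ : IsGeometry G L r b s) (hℓ : ℓ ∈ L) (hn : n ∈ L)
    (hdis : Disjoint n ℓ) (hp : p ∈ n) (hq : q ∈ n) (hpq : p ≠ q) (ha : a ∈ ℓ) (ha' : a' ∈ ℓ)
    (haa : a ≠ a') (h₁ : G.dist p a ≤ 2) (h₂ : G.dist p a' ≤ 2) (h₃ : G.dist q a ≤ 2)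
    (h₄ : G.dist q a' ≤ 2) : IsOpposite G n ℓ := by
  refine ⟨hdis, fun w hw => ?_⟩
  rw [dist_comm] at h₁ h₂ h₃ h₄
  have h5 := Γ.dist_line_le_two hn hp hq hpq h₁ h₃ hw
  have h6 := Γ.dist_line_le_two hn hp hq hpq h₂ h₄ hw
  rw [dist_comm] at h5 h6
  exact (Γ.mem_or_exists_adj hℓ ha ha' haa h5 h6).resolve_left (Finset.disjoint_left.1 hdis hw)

lemma opposite_symm (Γ : IsGeometry G L r b s) (hℓ : ℓ ∈ L) (hm : m ∈ L)
    (h : IsOpposite G ℓ m) : IsOpposite G m ℓ := by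
  obtain ⟨p, hp, q, hq, hpq⟩ := one_lt_card.1 (Γ.one_lt_card_line hℓ)
  obtain ⟨c, hc, d, hd, hcd⟩ := one_lt_card.1 (Γ.one_lt_card_line hm)
  have key : ∀ p ∈ ℓ, ∀ c ∈ m, G.dist c p ≤ 2 := fun p hp c hc => by
    rw [dist_comm]; exact Γ.dist_le_two_of_opposite hm h hp hc
  exact Γ.opposite_of_dist hℓ hm h.1.symm hc hd hcd hp hq hpq (key p hp c hc) (key q hq c hc)
    (key p hp d hd) (key q hq d hd)

/-- Two distinct lines meet in at most one point. -/
lemma eq_of_mem_lines (Γ : IsGeometry G L r b s) (hℓ : ℓ ∈ L) (ht : t ∈ L)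
    (hne : t ≠ ℓ) (ha : a ∈ ℓ) (hat : a ∈ t) (ha' : a' ∈ ℓ) (hat' : a' ∈ t) : a = a' := by
  by_contra h
  exact hne (Γ.lines.unique t ht ℓ hℓ a a' h hat hat' ha ha')

lemma transversal_ne (hdis : Disjoint ℓ m) (h : IsTransversal ℓ m t) : t ≠ ℓ ∧ t ≠ m := by
  obtain ⟨⟨a, ha, hat⟩, c, hc, hct⟩ := h
  exact ⟨fun h => Finset.disjoint_left.1 hdis (h ▸ hct) hc, fun h => Finset.disjoint_left.1 hdis ha (h ▸ hat)⟩

/-- A point of a transversal determines the point of the transversal on `ℓ`. -/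
lemma foot_eq (Γ : IsGeometry G L r b s) (hℓ : ℓ ∈ L) (ht : t ∈ L) (ht' : t' ∈ L)
    (hne : t ≠ ℓ) (hne' : t' ≠ ℓ) (hp : p ∈ t) (hp' : p ∈ t') (ha : a ∈ ℓ)
    (hat : a ∈ t) (ha' : a' ∈ ℓ) (hat' : a' ∈ t') : a = a' := by
  by_cases hpℓ : p ∈ ℓ
  · rw [← Γ.eq_of_mem_lines hℓ ht hne hpℓ hp ha hat,
      ← Γ.eq_of_mem_lines hℓ ht' hne' hpℓ hp' ha' hat']
  · exact Γ.neighbour_unique hℓ hpℓ ha ha'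
      (Γ.lines.adj t ht p hp a hat fun h => hpℓ (h ▸ ha))
      (Γ.lines.adj t' ht' p hp' a' hat' fun h => hpℓ (h ▸ ha'))

lemma transversal_unique (Γ : IsGeometry G L r b s) (hℓ : ℓ ∈ L) (hm : m ∈ L)
    (hdis : Disjoint ℓ m) (ht : t ∈ L) (ht' : t' ∈ L) (h : IsTransversal ℓ m t)
    (h' : IsTransversal ℓ m t') (hp : p ∈ t) (hp' : p ∈ t') : t = t' := by
  have hne := transversal_ne hdis h
  have hne' := transversal_ne hdis h'
  obtain ⟨⟨a, ha, hat⟩, c, hc, hct⟩ := h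
  obtain ⟨⟨a', ha', hat'⟩, c', hc', hct'⟩ := h'
  have h1 := Γ.foot_eq hℓ ht ht' hne.1 hne'.1 hp hp' ha hat ha' hat'
  have h2 := Γ.foot_eq hm ht ht' hne.2 hne'.2 hp hp' hc hct hc' hct'
  subst h1 h2
  exact Γ.lines.unique t ht t' ht' a c (fun h => Finset.disjoint_left.1 hdis ha (h ▸ hc)) hat hct hat' hct'

lemma exists_transversal (Γ : IsGeometry G L r b s) (h : IsOpposite G ℓ m) (ha : a ∈ ℓ) :
    ∃ t ∈ L, IsTransversal ℓ m t ∧ a ∈ t := by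
  obtain ⟨c, hc, hac⟩ := h.2 a ha
  obtain ⟨t, ht, hat, hct⟩ := Γ.lines.cover a c hac
  exact ⟨t, ht, ⟨⟨a, ha, hat⟩, c, hc, hct⟩, hat⟩

lemma card_transversals (Γ : IsGeometry G L r b s) (hℓ : ℓ ∈ L) (hm : m ∈ L)
    (h : IsOpposite G ℓ m) : #{t ∈ L | IsTransversal ℓ m t} = s + 1 := by
  rw [← Γ.card_line ℓ hℓ]
  symm
  have hex := fun a (ha : a ∈ ℓ) => Γ.exists_transversal h ha
  choose! T hT using hex
  refine card_bij (fun a _ => T a) (fun a ha => ?_) (fun a ha a' ha' heq => ?_) fun t ht => ?_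
  · rw [mem_filter]
    exact ⟨(hT a ha).1, (hT a ha).2.1⟩
  · exact Γ.eq_of_mem_lines hℓ (hT a ha).1 (transversal_ne h.1 (hT a ha).2.1).1 ha
      (hT a ha).2.2 ha' (heq ▸ (hT a' ha').2.2)
  · rw [mem_filter] at ht
    obtain ⟨a, ha, hat⟩ := ht.2.1
    exact ⟨a, ha, Γ.transversal_unique hℓ hm h.1 (hT a ha).1 ht.1 (hT a ha).2.1 ht.2
      (hT a ha).2.2 hat⟩

/-- Lines through `z` that contain a neighbour of a point at distance two from `z`. -/
lemma card_lines_near_le (Γ : IsGeometry G L r b s) {S : Finset (Finset V)}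
    (hS : ∀ n ∈ S, n ∈ L ∧ z ∈ n ∧ ∃ w ∈ n, G.Adj a w) (hne : z ≠ a) (hna : ¬ G.Adj z a) :
    #S ≤ b + 1 := by
  refine le_trans ?_ (Γ.params.card_common_le hne hna)
  have hex := fun n (hn : n ∈ S) => (hS n hn).2.2
  have : Nonempty V := ⟨z⟩
  choose! w hw using hex
  have hzw : ∀ n ∈ S, z ≠ w n := fun n hn h => hna (h ▸ (hw n hn).2.symm)
  refine card_le_card_of_injOn w (fun n hn => ?_) fun n hn n' hn' heq => ?_
  · simp only [coe_filter, mem_univ, true_and, Set.mem_ofPred_eq]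
    exact ⟨Γ.lines.adj n (hS n hn).1 z (hS n hn).2.1 _ (hw n hn).1 (hzw n hn), (hw n hn).2⟩
  · exact Γ.lines.unique n (hS n hn).1 n' (hS n' hn').1 z (w n) (hzw n hn) (hS n hn).2.1
      (hw n hn).1 (hS n' hn').2.1 (heq ▸ (hw n' hn').1)

/-- Counting the points of a set collinear with `z` through a line of `N`. -/
lemma card_collinear (Γ : IsGeometry G L r b s) {N : Finset (Finset V)} (hN : N ⊆ L)
    (S : Finset V) (z : V) :
    #{y ∈ S | ∃ n ∈ N, z ∈ n ∧ y ∈ n ∧ y ≠ z} = ∑ n ∈ N with z ∈ n, #((n ∩ S).erase z) := by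
  rw [← card_biUnion]
  · congr 1
    ext y
    simp only [mem_filter, mem_biUnion, mem_erase, mem_inter]
    constructor
    · rintro ⟨hy, n, hn, hz, hyn, hne⟩
      exact ⟨n, ⟨hn, hz⟩, hne, hyn, hy⟩
    · rintro ⟨n, ⟨hn, hz⟩, hne, hyn, hy⟩
      exact ⟨hy, n, hn, hz, hyn, hne⟩
  · intro n hn n' hn' hne
    rw [Function.onFun, Finset.disjoint_left]
    intro y hy hy'
    simp only [coe_filter, Set.mem_ofPred_eq, mem_erase, mem_inter] at hn hn' hy hy'
    exact hne (Γ.lines.unique n (hN hn.1) n' (hN hn'.1) y z hy.1 hy.2.1 hn.2 hy'.2.1 hn'.2)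

end IsGeometry

/-- The final inequality of the double count, where `N`, `A`, `B` are the sums of `X ^ 0`,
`X ^ 1`, `X ^ 2`. -/
lemma le_sq_of_moments {t s N A B : ℝ} (ht : 2 ≤ t) (hA : 0 < A)
    (h₁ : t * B ≤ (s + t) * A)
    (h₂ : (s - 1) * ((s + 1) * N - A) ≤ (t - 1) * ((s + 1) * A - B))
    (h₃ : 0 ≤ t ^ 2 * B - 2 * t * (s + t) * A + (s + t) ^ 2 * N) : s ≤ t ^ 2 := by
  by_contra! hs
  have hs1 : 4 < s := by nlinarith
  have hst : t < s := by nlinarith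
  have hc : (s + t) ^ 2 * (t - 1) - t ^ 2 * (s ^ 2 - 1) ≤ 0 := by
    have e1 : s * t ^ 2 ≤ s ^ 2 := by nlinarith
    have e2 : 3 ≤ t ^ 2 - t + 1 := by nlinarith
    have e3 : s * t ^ 2 * 3 ≤ s ^ 2 * (t ^ 2 - t + 1) :=
      mul_le_mul e1 e2 (by norm_num) (by positivity)
    have e4 : t ^ 2 * t ≤ t ^ 2 * s := mul_le_mul_of_nonneg_left hst.le (by positivity)
    have e5 : 0 ≤ s * t := by nlinarith
    nlinarith
  have h4 : (s ^ 2 - 1) * (2 * t * (s + t) * A - t ^ 2 * B) ≤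
      (s + t) ^ 2 * ((t * s + t - 2) * A - (t - 1) * B) := by
    have e1 : 0 ≤ (s ^ 2 - 1) := by nlinarith
    have e2 := mul_nonneg e1 h₃
    have e3 := mul_le_mul_of_nonneg_left h₂ (sq_nonneg (s + t))
    nlinarith
  have h5 := mul_le_mul_of_nonpos_left h₁ hc
  have h6 : (s + t) * A * (s * (t - 1) * (s - t ^ 2)) ≤ 0 := by
    have e := mul_le_mul_of_nonneg_left h4 (by linarith : (0 : ℝ) ≤ t)
    linarith
  have h7 : 0 < (s + t) * A * (s * (t - 1) * (s - t ^ 2)) := by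
    have e1 : 0 < s - t ^ 2 := by linarith
    have e2 : 0 < t - 1 := by linarith
    have e3 : 0 < s := by linarith
    have e4 : 0 < s + t := by linarith
    positivity
  linarith

lemma sum_card_inter_mul (N : Finset (Finset V)) (S : Finset V) (f : Finset V → ℝ) :
    ∑ p ∈ S, ∑ n ∈ N with p ∈ n, f n = ∑ n ∈ N, #(n ∩ S) * f n := by
  rw [sum_comm' (t' := N) (s' := fun n => n ∩ S)]
  · simp
  · intro p n
    simp only [mem_filter, mem_inter]
    tauto

/-- Double counting of the incidences between the lines of `N` and a set `S` of points. -/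
lemma le_sq_of_incidences {N : Finset (Finset V)} {S : Finset V} (hb : 2 ≤ b)
    (hcard : ∀ n ∈ N, #n = s + 1)
    (hin : ∀ p ∈ S, (b : ℝ) * ∑ n ∈ N with p ∈ n, (#(n ∩ S) : ℝ) ≤
      (s + b) * #{n ∈ N | p ∈ n})
    (hout : ∀ z ∉ S, ((s : ℝ) - 1) * #{n ∈ N | z ∈ n} ≤
      (b - 1) * ∑ n ∈ N with z ∈ n, (#(n ∩ S) : ℝ))
    (hpos : ∃ n ∈ N, (n ∩ S).Nonempty) : s ≤ b ^ 2 := by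
  set A : ℝ := ∑ n ∈ N, (#(n ∩ S) : ℝ) with hA
  set B : ℝ := ∑ n ∈ N, (#(n ∩ S) : ℝ) ^ 2 with hB
  have hone : ∀ T : Finset V, ∑ p ∈ T, (#{n ∈ N | p ∈ n} : ℝ) = ∑ n ∈ N, (#(n ∩ T) : ℝ) := by
    intro T
    have := sum_card_inter_mul N T fun _ => 1
    simpa using this
  have hcompl : ∀ n ∈ N, (#(n ∩ Sᶜ) : ℝ) = s + 1 - #(n ∩ S) := by
    intro n hn
    have h := card_inter_add_card_sdiff n S
    rw [hcard n hn, sdiff_eq_inter_compl] at h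
    have : (#(n ∩ S) : ℝ) + #(n ∩ Sᶜ) = s + 1 := by exact_mod_cast h
    linarith
  have h₁ : (b : ℝ) * B ≤ (s + b) * A := by
    have := sum_le_sum hin
    rw [← mul_sum, ← mul_sum, sum_card_inter_mul, hone S] at this
    simpa only [hA, hB, sq] using this
  have h₂ : ((s : ℝ) - 1) * ((s + 1) * #N - A) ≤ (b - 1) * ((s + 1) * A - B) := by
    have := sum_le_sum fun z (hz : z ∈ Sᶜ) => hout z (mem_compl.1 hz)
    rw [← mul_sum, ← mul_sum, sum_card_inter_mul, hone] at this
    have e1 : ∑ n ∈ N, (#(n ∩ Sᶜ) : ℝ) = (s + 1) * #N - A := by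
      rw [sum_congr rfl hcompl, sum_sub_distrib, sum_const, nsmul_eq_mul]
      ring
    have e2 : ∑ n ∈ N, (#(n ∩ Sᶜ) : ℝ) * #(n ∩ S) = (s + 1) * A - B := by
      rw [hA, hB, mul_sum, ← sum_sub_distrib]
      exact sum_congr rfl fun n hn => by rw [hcompl n hn]; ring
    rwa [e1, e2] at this
  have h₃ : 0 ≤ (b : ℝ) ^ 2 * B - 2 * b * (s + b) * A + (s + b) ^ 2 * #N := by
    have h : 0 ≤ ∑ n ∈ N, ((b : ℝ) * #(n ∩ S) - (s + b)) ^ 2 :=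
      sum_nonneg fun _ _ => sq_nonneg _
    have e : ∑ n ∈ N, ((b : ℝ) * #(n ∩ S) - (s + b)) ^ 2 =
        (b : ℝ) ^ 2 * B - 2 * b * (s + b) * A + (s + b) ^ 2 * #N := by
      rw [hA, hB, mul_sum, mul_sum, ← sum_sub_distrib,
        show ((s : ℝ) + b) ^ 2 * #N = ∑ n ∈ N, ((s : ℝ) + b) ^ 2 by
          rw [sum_const, nsmul_eq_mul]; ring, ← sum_add_distrib]
      exact sum_congr rfl fun n _ => by ring
    rwa [e] at h
  have hApos : 0 < A := by
    obtain ⟨n, hn, hne⟩ := hpos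
    exact sum_pos' (fun _ _ => Nat.cast_nonneg _) ⟨n, hn, by exact_mod_cast hne.card_pos⟩
  have := le_sq_of_moments (by exact_mod_cast hb) hApos h₁ h₂ h₃
  exact_mod_cast this

namespace IsGeometry

variable {L : Finset (Finset V)} {ℓ m n t t' : Finset V} {x y z u v p q a a' c c' : V}

/-- The lines opposite to both `ℓ` and `m`. -/
noncomputable def oppositeLines (G : SimpleGraph V) (L : Finset (Finset V)) (ℓ m : Finset V) :
    Finset (Finset V) :=
  {n ∈ L | IsOpposite G n ℓ ∧ IsOpposite G n m}

/-- The points on the transversals of `ℓ` and `m`. -/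
noncomputable def transversalPoints (L : Finset (Finset V)) (ℓ m : Finset V) : Finset V :=
  {p | ∃ t ∈ L, IsTransversal ℓ m t ∧ p ∈ t}

lemma mem_transversalPoints :
    p ∈ transversalPoints L ℓ m ↔ ∃ t ∈ L, IsTransversal ℓ m t ∧ p ∈ t := by
  simp [transversalPoints]

lemma mem_oppositeLines :
    n ∈ oppositeLines G L ℓ m ↔ n ∈ L ∧ IsOpposite G n ℓ ∧ IsOpposite G n m := by
  simp [oppositeLines]

/-- A line through a point `p` of a transversal `t`, other than `t`, which contains a point close to
another point of `ℓ`, is opposite to `ℓ`. -/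
lemma opposite_of_transversal (Γ : IsGeometry G L r b s) (hℓ : ℓ ∈ L) (ht : t ∈ L)
    (hpt : p ∈ t) (hpℓ : p ∉ ℓ) (ha : a ∈ ℓ) (hat : a ∈ t) (ha' : a' ∈ ℓ) (haa : a ≠ a')
    (hn : n ∈ L) (hnt : n ≠ t) (hp : p ∈ n) (hq : q ∈ n) (hpq : p ≠ q)
    (hqa : G.dist q a' ≤ 2) : IsOpposite G n ℓ := by
  have hpa : G.Adj p a := Γ.lines.adj t ht p hpt a hat fun h => hpℓ (h ▸ ha)
  have hdis : Disjoint n ℓ := by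
    rw [Finset.disjoint_left]
    intro w hw hwℓ
    have hpw : p ≠ w := fun h => hpℓ (h ▸ hwℓ)
    have := Γ.neighbour_unique hℓ hpℓ hwℓ ha (Γ.lines.adj n hn p hp w hw hpw) hpa
    subst this
    exact hnt (Γ.lines.unique n hn t ht p w hpw hp hw hpt hat)
  refine Γ.opposite_of_dist hℓ hn hdis hp hq hpq ha ha' haa ?_
    (Γ.dist_le_two_of_mem hℓ ha ha' hpa) ?_ hqa
  · rw [dist_eq_one_iff_adj.2 hpa]; omega
  · exact Γ.params.dist_le_two (Γ.lines.adj n hn q hq p hp hpq.symm) hpa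

lemma le_card_oppositeLines (Γ : IsGeometry G L r b s) (hℓ : ℓ ∈ L) (hm : m ∈ L)
    (h : IsOpposite G ℓ m) (ht : t ∈ L) (htr : IsTransversal ℓ m t) (hp : p ∈ t)
    (hpℓ : p ∉ ℓ) (hpm : p ∉ m) : b ≤ #{n ∈ oppositeLines G L ℓ m | p ∈ n} := by
  have hne := transversal_ne h.1 htr
  obtain ⟨⟨a, ha, hat⟩, c, hc, hct⟩ := htr
  obtain ⟨a', ha', haa⟩ := exists_mem_ne (Γ.one_lt_card_line hℓ) a
  obtain ⟨t', ht', htr', hat'⟩ := Γ.exists_transversal h ha'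
  have hne' := transversal_ne h.1 htr'
  obtain ⟨-, c', hc', hct'⟩ := htr'
  have hac' : G.Adj a' c' := Γ.lines.adj t' ht' a' hat' c' hct'
    fun e => Finset.disjoint_left.1 h.1 ha' (e ▸ hc')
  have hcc : c ≠ c' := by
    rintro rfl
    exact haa (Γ.foot_eq hℓ ht' ht hne'.1 hne.1 hct' hct ha' hat' ha hat)
  have hpa : G.Adj p a := Γ.lines.adj t ht p hp a hat fun e => hpℓ (e ▸ ha)
  have hpa' : ¬ G.Adj p a' := fun e => haa (Γ.neighbour_unique hℓ hpℓ ha' ha e hpa)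
  have hd : G.dist p a' = 2 := Γ.params.dist_eq_two (Γ.dist_le_two_of_mem hℓ ha ha' hpa)
    (fun e => hpℓ (e ▸ ha')) hpa'
  have hat'' : a' ∉ t := fun e => haa (Γ.eq_of_mem_lines hℓ ht hne.1 ha' e ha hat)
  set W : Finset V := ({w | G.Adj p w ∧ G.Adj a' w} : Finset V).erase a with hW
  have memW : ∀ w ∈ W, w ≠ a ∧ G.Adj p w ∧ G.Adj a' w := fun w hw => by simpa [hW] using hw
  have hWc : #W = b := by
    rw [hW, card_erase_of_mem, Γ.params.common_two p a' hd]
    · omega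
    · simp [hpa, Γ.lines.adj ℓ hℓ a' ha' a ha haa]
  rw [← hWc]
  choose! line hline using Γ.lines.cover
  refine card_le_card_of_injOn (fun w => line p w) (fun w hw => ?_) fun w hw w' hw' heq => ?_
  · obtain ⟨hwa, hpw, haw⟩ := memW w hw
    obtain ⟨h1, h2, h3⟩ := hline p w hpw
    have hnt : line p w ≠ t := by
      intro e
      rw [e] at h3
      exact hwa (Γ.neighbour_unique ht hat'' h3 hat haw (Γ.lines.adj ℓ hℓ a' ha' a ha haa))
    simp only [coe_filter, Set.mem_ofPred_eq, mem_oppositeLines]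
    refine ⟨⟨h1, Γ.opposite_of_transversal hℓ ht hp hpℓ ha hat ha' haa.symm h1 hnt h2 h3 hpw.ne ?_,
      Γ.opposite_of_transversal hm ht hp hpm hc hct hc' hcc h1 hnt h2 h3 hpw.ne ?_⟩, h2⟩
    · rw [dist_eq_one_iff_adj.2 haw.symm]; omega
    · exact Γ.params.dist_le_two haw.symm hac'
  · obtain ⟨hwa, hpw, haw⟩ := memW w hw
    obtain ⟨hwa', hpw', haw'⟩ := memW w' hw'
    obtain ⟨h1, h2, h3⟩ := hline p w hpw
    obtain ⟨h1', h2', h3'⟩ := hline p w' hpw'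
    simp only at heq
    rw [← heq] at h3'
    refine Γ.neighbour_unique h1 (fun e => ?_) h3 h3' haw haw'
    exact hpa' (Γ.lines.adj _ h1 p h2 a' e fun e => hpℓ (e ▸ ha'))

lemma card_collinear_transversalPoints_le (Γ : IsGeometry G L r b s) (hℓ : ℓ ∈ L) (hm : m ∈ L)
    (h : IsOpposite G ℓ m) (ht : t ∈ L) (htr : IsTransversal ℓ m t) (hp : p ∈ t) :
    #{y ∈ transversalPoints L ℓ m | ∃ n ∈ oppositeLines G L ℓ m, p ∈ n ∧ y ∈ n ∧ y ≠ p} ≤ s := by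
  have hTc : #(({t ∈ L | IsTransversal ℓ m t} : Finset _).erase t) = s := by
    rw [card_erase_of_mem (by simp [ht, htr]), Γ.card_transversals hℓ hm h]
    omega
  rw [← hTc]
  have hex : ∀ y ∈ transversalPoints L ℓ m, ∃ t ∈ L, IsTransversal ℓ m t ∧ y ∈ t :=
    fun y hy => mem_transversalPoints.1 hy
  choose! T hT using hex
  have hTt : ∀ y ∈ transversalPoints L ℓ m, ∀ n ∈ oppositeLines G L ℓ m, p ∈ n → y ∈ n → y ≠ p →
      T y ≠ t := by
    intro y hy n hn hpn hyn hne heq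
    obtain ⟨-, -, h3⟩ := hT y hy
    rw [heq] at h3
    rw [mem_oppositeLines] at hn
    have := Γ.lines.unique n hn.1 t ht y p hne hyn hpn h3 hp
    obtain ⟨a, ha, hat⟩ := htr.1
    exact Finset.disjoint_left.1 hn.2.1.1 (this ▸ hat) ha
  refine card_le_card_of_injOn T (fun y hy => ?_) fun y hy y' hy' heq => ?_
  · simp only [coe_filter, Set.mem_ofPred_eq] at hy
    obtain ⟨hyS, n, hn, hpn, hyn, hne⟩ := hy
    obtain ⟨h1, h2, -⟩ := hT y hyS
    simp only [coe_erase, coe_filter, Set.mem_sdiff, Set.mem_ofPred_eq, Set.mem_singleton_iff]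
    exact ⟨⟨h1, h2⟩, hTt y hyS n hn hpn hyn hne⟩
  · simp only [coe_filter, Set.mem_ofPred_eq] at hy hy'
    obtain ⟨hyS, n, hn, hpn, hyn, hne⟩ := hy
    obtain ⟨hyS', n', hn', hpn', hyn', hne'⟩ := hy'
    obtain ⟨h1, h2, h3⟩ := hT y hyS
    obtain ⟨-, -, h3'⟩ := hT y' hyS'
    rw [← heq] at h3'
    have hadj : ∀ n ∈ oppositeLines G L ℓ m, ∀ y ∈ n, p ∈ n → y ≠ p → G.Adj p y :=
      fun n hn y hy hp hne => Γ.lines.adj n (mem_oppositeLines.1 hn).1 p hp y hy hne.symm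
    refine Γ.neighbour_unique h1 (fun e => hTt y hyS n hn hpn hyn hne ?_) h3 h3'
      (hadj n hn y hyn hpn hne) (hadj n' hn' y' hyn' hpn' hne')
    exact Γ.transversal_unique hℓ hm h.1 h1 ht h2 htr e hp

lemma sum_inter_le (Γ : IsGeometry G L r b s) (hℓ : ℓ ∈ L) (hm : m ∈ L)
    (h : IsOpposite G ℓ m) (hp : p ∈ transversalPoints L ℓ m) :
    (b : ℝ) * ∑ n ∈ oppositeLines G L ℓ m with p ∈ n, (#(n ∩ transversalPoints L ℓ m) : ℝ) ≤
      (s + b) * #{n ∈ oppositeLines G L ℓ m | p ∈ n} := by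
  obtain ⟨t, ht, htr, hpt⟩ := mem_transversalPoints.1 hp
  by_cases hz : #{n ∈ oppositeLines G L ℓ m | p ∈ n} = 0
  · rw [hz, card_eq_zero.1 hz]
    simp
  obtain ⟨n, hn⟩ := card_pos.1 (Nat.pos_of_ne_zero hz)
  rw [mem_filter, mem_oppositeLines] at hn
  obtain ⟨⟨-, h1, h2⟩, hpn⟩ := hn
  have hdeg := Γ.le_card_oppositeLines hℓ hm h ht htr hpt (Finset.disjoint_left.1 h1.1 hpn)
    (Finset.disjoint_left.1 h2.1 hpn)
  have hcol := Γ.card_collinear_transversalPoints_le hℓ hm h ht htr hpt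
  rw [Γ.card_collinear (N := oppositeLines G L ℓ m) (filter_subset _ _)] at hcol
  have hsum : ∑ n ∈ oppositeLines G L ℓ m with p ∈ n, #(n ∩ transversalPoints L ℓ m) =
      ∑ n ∈ oppositeLines G L ℓ m with p ∈ n, #((n ∩ transversalPoints L ℓ m).erase p) +
        #{n ∈ oppositeLines G L ℓ m | p ∈ n} := by
    rw [card_eq_sum_ones, ← sum_add_distrib]
    refine sum_congr rfl fun n hn => ?_
    rw [card_erase_add_one]
    exact mem_inter.2 ⟨(mem_filter.1 hn).2, hp⟩
  have key : b * ∑ n ∈ oppositeLines G L ℓ m with p ∈ n, #(n ∩ transversalPoints L ℓ m) ≤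
      (s + b) * #{n ∈ oppositeLines G L ℓ m | p ∈ n} := by
    rw [hsum]
    nlinarith [Nat.mul_le_mul_left b hcol, Nat.mul_le_mul_left s hdeg]
  exact_mod_cast key

end IsGeometry

namespace IsGeometry

variable {L : Finset (Finset V)} {ℓ m n t t' : Finset V} {x y z u v p q w a a' c c' : V}

lemma opposite_of_adj (Γ : IsGeometry G L r b s) (hℓ : ℓ ∈ L) (hz : z ∉ ℓ) (ha' : a' ∈ ℓ)
    (hza : G.Adj z a') (ht : t ∈ L) (ha : a ∈ ℓ) (hat : a ∈ t) (hat' : a' ∉ t) (hw : w ∈ t)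
    (hzw : G.Adj z w) (hn : n ∈ L) (hzn : z ∈ n) (hwn : w ∈ n) : IsOpposite G n ℓ := by
  obtain ⟨k, hk, hzk, hak⟩ := Γ.lines.cover z a' hza
  have hne : a' ≠ a := fun e => hat' (e ▸ hat)
  have hwa' : w ≠ a' := fun e => hat' (e ▸ hw)
  have hnk : n ≠ k := by
    rintro rfl
    have hwadj := Γ.lines.adj n hn w hwn a' hak hwa'
    by_cases hwℓ : w ∈ ℓ
    · exact hwa' (Γ.neighbour_unique hℓ hz hwℓ ha' hzw hza)
    · exact hne (Γ.neighbour_unique hℓ hwℓ ha' ha hwadj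
        (Γ.lines.adj t ht w hw a hat fun e => hwℓ (e ▸ ha)))
  refine Γ.opposite_of_transversal hℓ hk hzk hz ha' hak ha hne hn hnk hzn hwn hzw.ne ?_
  by_cases hwa : w = a
  · simp [hwa]
  · rw [dist_eq_one_iff_adj.2 (Γ.lines.adj t ht w hw a hat hwa)]; omega

lemma le_card_collinear_transversalPoints (Γ : IsGeometry G L r b s) (hℓ : ℓ ∈ L) (hm : m ∈ L)
    (h : IsOpposite G ℓ m) (hz : z ∉ transversalPoints L ℓ m) (ha : a ∈ ℓ) (hza : G.Adj z a)
    (hc : c ∈ m) (hzc : G.Adj z c) (hzℓ : z ∉ ℓ) (hzm : z ∉ m) :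
    s ≤ #{y ∈ transversalPoints L ℓ m |
      ∃ n ∈ oppositeLines G L ℓ m, z ∈ n ∧ y ∈ n ∧ y ≠ z} + 1 := by
  set T : Finset (Finset V) := {t ∈ {t ∈ L | IsTransversal ℓ m t} | a ∉ t ∧ c ∉ t} with hT
  have hTc : s ≤ #T + 1 := by
    obtain ⟨t₁, ht₁, htr₁, hat₁⟩ := Γ.exists_transversal h ha
    obtain ⟨d, hd, hcd⟩ := (Γ.opposite_symm hℓ hm h).2 c hc
    obtain ⟨t₂, ht₂, hct₂, hdt₂⟩ := Γ.lines.cover c d hcd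
    have htr₂ : IsTransversal ℓ m t₂ := ⟨⟨d, hd, hdt₂⟩, c, hc, hct₂⟩
    have hsub : ({t ∈ L | IsTransversal ℓ m t} : Finset _) ⊆ insert t₁ (insert t₂ T) := by
      intro t ht
      simp only [hT, mem_insert, mem_filter] at ht ⊢
      by_cases hat : a ∈ t
      · exact Or.inl (Γ.transversal_unique hℓ hm h.1 ht.1 ht₁ ht.2 htr₁ hat hat₁)
      by_cases hct : c ∈ t
      · exact Or.inr (Or.inl (Γ.transversal_unique hℓ hm h.1 ht.1 ht₂ ht.2 htr₂ hct hct₂))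
      exact Or.inr (Or.inr ⟨ht, hat, hct⟩)
    have h1 := card_le_card hsub
    have h2 := card_insert_le t₁ (insert t₂ T)
    have h3 := card_insert_le t₂ T
    rw [Γ.card_transversals hℓ hm h] at h1
    omega
  refine hTc.trans (Nat.add_le_add_right ?_ 1)
  have memT : ∀ t ∈ T, t ∈ L ∧ IsTransversal ℓ m t ∧ a ∉ t ∧ c ∉ t := fun t ht => by
    simp only [hT, mem_filter] at ht
    exact ⟨ht.1.1, ht.1.2, ht.2⟩
  have hex : ∀ t ∈ T, ∃ w ∈ t, G.Adj z w := by
    intro t ht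
    obtain ⟨htL, htr, -⟩ := memT t ht
    obtain ⟨⟨a', ha', hat'⟩, c', hc', hct'⟩ := id htr
    refine (Γ.mem_or_exists_adj htL hat' hct' (fun e => Finset.disjoint_left.1 h.1 ha' (e ▸ hc'))
      (Γ.dist_le_two_of_mem hℓ ha ha' hza) (Γ.dist_le_two_of_mem hm hc hc' hzc)).resolve_left
      fun hzt => hz (mem_transversalPoints.2 ⟨t, htL, htr, hzt⟩)
  have : Nonempty V := ⟨z⟩
  choose! w hw using hex
  refine card_le_card_of_injOn w (fun t ht => ?_) fun t ht t' ht' heq => ?_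
  · obtain ⟨htL, htr, hat, hct⟩ := memT t ht
    obtain ⟨⟨a', ha', hat'⟩, c', hc', hct'⟩ := id htr
    obtain ⟨hwt, hzw⟩ := hw t ht
    obtain ⟨n, hn, hzn, hwn⟩ := Γ.lines.cover z (w t) hzw
    simp only [coe_filter, Set.mem_ofPred_eq, mem_transversalPoints, mem_oppositeLines]
    exact ⟨⟨t, htL, htr, hwt⟩, n, ⟨hn,
      Γ.opposite_of_adj hℓ hzℓ ha hza htL ha' hat' hat hwt hzw hn hzn hwn,
      Γ.opposite_of_adj hm hzm hc hzc htL hc' hct' hct hwt hzw hn hzn hwn⟩, hzn, hwn, hzw.ne'⟩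
  · obtain ⟨htL, htr, -⟩ := memT t ht
    obtain ⟨htL', htr', -⟩ := memT t' ht'
    exact Γ.transversal_unique hℓ hm h.1 htL htL' htr htr' (hw t ht).1 (heq ▸ (hw t' ht').1)

lemma card_oppositeLines_lt (Γ : IsGeometry G L r b s) (hℓ : ℓ ∈ L) (hm : m ∈ L)
    (h : IsOpposite G ℓ m) (hz : z ∉ transversalPoints L ℓ m) (ha : a ∈ ℓ) (hza : G.Adj z a)
    (hc : c ∈ m) (hzc : G.Adj z c) (hzℓ : z ∉ ℓ) :
    #{n ∈ oppositeLines G L ℓ m | z ∈ n} < b := by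
  obtain ⟨k, hk, hzk, hak⟩ := Γ.lines.cover z a hza
  obtain ⟨k', hk', hzk', hck'⟩ := Γ.lines.cover z c hzc
  obtain ⟨a', ha', haa⟩ := exists_mem_ne (Γ.one_lt_card_line hℓ) a
  have hza' : ¬ G.Adj z a' := fun e => haa (Γ.neighbour_unique hℓ hzℓ ha' ha e hza)
  have hzne : z ≠ a' := fun e => hzℓ (e ▸ ha')
  have hcard := Γ.card_lines_near_le (z := z) (a := a')
    (S := insert k (insert k' {n ∈ oppositeLines G L ℓ m | z ∈ n})) (fun n hn => ?_) hzne hza'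
  · rw [card_insert_of_notMem, card_insert_of_notMem] at hcard
    · omega
    · intro hmem
      rw [mem_filter, mem_oppositeLines] at hmem
      exact Finset.disjoint_left.1 hmem.1.2.2.1 hck' hc
    · intro hmem
      rw [mem_insert, mem_filter, mem_oppositeLines] at hmem
      rcases hmem with rfl | hmem
      · exact hz (mem_transversalPoints.2 ⟨k, hk, ⟨⟨a, ha, hak⟩, c, hc, hck'⟩, hzk⟩)
      · exact Finset.disjoint_left.1 hmem.1.2.1.1 hak ha
  · rw [mem_insert, mem_insert, mem_filter, mem_oppositeLines] at hn
    rcases hn with rfl | rfl | ⟨⟨hn, hop, -⟩, hzn⟩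
    · exact ⟨hk, hzk, a, hak, Γ.lines.adj ℓ hℓ a' ha' a ha haa⟩
    · refine ⟨hk', hzk', (Γ.mem_or_exists_adj hk' hzk' hck' hzc.ne ?_
        (Γ.dist_le_two_of_opposite hm h ha' hc)).resolve_left fun e =>
          hza' (Γ.lines.adj n hk' z hzk' a' e hzne)⟩
      rw [dist_comm]
      exact Γ.dist_le_two_of_mem hℓ ha ha' hza
    · exact ⟨hn, hzn, (Γ.opposite_symm hn hℓ hop).2 a' ha'⟩

lemma le_sum_inter (Γ : IsGeometry G L r b s) (hℓ : ℓ ∈ L) (hm : m ∈ L)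
    (h : IsOpposite G ℓ m) (hz : z ∉ transversalPoints L ℓ m) :
    ((s : ℝ) - 1) * #{n ∈ oppositeLines G L ℓ m | z ∈ n} ≤
      (b - 1) * ∑ n ∈ oppositeLines G L ℓ m with z ∈ n, (#(n ∩ transversalPoints L ℓ m) : ℝ) := by
  by_cases h0 : #{n ∈ oppositeLines G L ℓ m | z ∈ n} = 0
  · rw [h0, card_eq_zero.1 h0]
    simp
  obtain ⟨n, hn⟩ := card_pos.1 (Nat.pos_of_ne_zero h0)
  rw [mem_filter, mem_oppositeLines] at hn
  obtain ⟨⟨-, h1, h2⟩, hzn⟩ := hn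
  obtain ⟨a, ha, hza⟩ := h1.2 z hzn
  obtain ⟨c, hc, hzc⟩ := h2.2 z hzn
  have hzℓ := Finset.disjoint_left.1 h1.1 hzn
  have hzm := Finset.disjoint_left.1 h2.1 hzn
  have hdeg := Γ.card_oppositeLines_lt hℓ hm h hz ha hza hc hzc hzℓ
  have hcol := Γ.le_card_collinear_transversalPoints hℓ hm h hz ha hza hc hzc hzℓ hzm
  rw [Γ.card_collinear (N := oppositeLines G L ℓ m) (filter_subset _ _)] at hcol
  have hle : ∑ n ∈ oppositeLines G L ℓ m with z ∈ n, #((n ∩ transversalPoints L ℓ m).erase z) ≤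
      ∑ n ∈ oppositeLines G L ℓ m with z ∈ n, #(n ∩ transversalPoints L ℓ m) :=
    sum_le_sum fun n _ => card_erase_le
  have e1 : (#{n ∈ oppositeLines G L ℓ m | z ∈ n} : ℝ) ≤ b - 1 := by
    have : (#{n ∈ oppositeLines G L ℓ m | z ∈ n} : ℝ) + 1 ≤ b := by exact_mod_cast hdeg
    linarith
  have e2 : (s : ℝ) - 1 ≤
      ∑ n ∈ oppositeLines G L ℓ m with z ∈ n, (#(n ∩ transversalPoints L ℓ m) : ℝ) := by
    have := hcol.trans (Nat.add_le_add_right hle 1)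
    have : (s : ℝ) ≤
        ∑ n ∈ oppositeLines G L ℓ m with z ∈ n, (#(n ∩ transversalPoints L ℓ m) : ℝ) + 1 := by
      exact_mod_cast this
    linarith
  have e3 : (1 : ℝ) ≤ s := by
    have := Γ.sq_lt
    exact_mod_cast (by omega : 1 ≤ s)
  have e4 : (2 : ℝ) ≤ b := by exact_mod_cast Γ.two_le
  rw [mul_comm]
  exact mul_le_mul e1 e2 (by linarith) (by linarith)

/-- Such a geometry has no opposite lines. -/
lemma not_isOpposite (Γ : IsGeometry G L r b s) (hℓ : ℓ ∈ L) (hm : m ∈ L) :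
    ¬ IsOpposite G ℓ m := by
  intro h
  refine (not_le.2 Γ.sq_lt) (le_sq_of_incidences (N := oppositeLines G L ℓ m)
    (S := transversalPoints L ℓ m) Γ.two_le (fun n hn => Γ.card_line n (mem_oppositeLines.1 hn).1)
    (fun p hp => Γ.sum_inter_le hℓ hm h hp) (fun z hz => Γ.le_sum_inter hℓ hm h hz) ?_)
  obtain ⟨a, ha⟩ := card_pos.1 (zero_lt_one.trans (Γ.one_lt_card_line hℓ))
  obtain ⟨t, ht, htr, hat⟩ := Γ.exists_transversal h ha
  have hne := transversal_ne h.1 htr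
  obtain ⟨-, c, hc, hct⟩ := id htr
  have hpos : 0 < #((t.erase a).erase c) := by
    have h1 := Γ.card_line t ht
    have h2 := pred_card_le_card_erase (s := t) (a := a)
    have h3 := pred_card_le_card_erase (s := t.erase a) (a := c)
    have h4 := Γ.sq_lt
    have h5 := Γ.two_le
    have h6 : 2 ^ 2 ≤ b ^ 2 := Nat.pow_le_pow_left h5 2
    omega
  obtain ⟨p, hp⟩ := card_pos.1 hpos
  simp only [mem_erase] at hp
  have hdeg := Γ.le_card_oppositeLines hℓ hm h ht htr hp.2.2
    (fun e => hp.2.1 (Γ.eq_of_mem_lines hℓ ht hne.1 e hp.2.2 ha hat))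
    (fun e => hp.1 (Γ.eq_of_mem_lines hm ht hne.2 e hp.2.2 hc hct))
  obtain ⟨n, hn⟩ := card_pos.1 (lt_of_lt_of_le (by have := Γ.two_le; omega) hdeg)
  rw [mem_filter] at hn
  exact ⟨n, hn.1, p, mem_inter.2 ⟨hn.2, mem_transversalPoints.2 ⟨t, ht, htr, hp.2.2⟩⟩⟩

lemma dist_ne_two (Γ : IsGeometry G L r b s) (x y : V) : G.dist x y ≠ 2 := by
  intro hd
  have hxy : ¬ G.Adj x y := fun h => by rw [dist_eq_one_iff_adj.2 h] at hd; omega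
  have hne : x ≠ y := by
    rintro rfl
    simp at hd
  have hcard := Γ.params.common_two x y hd
  obtain ⟨w, hw, w', hw', hww⟩ := one_lt_card.1 (by rw [hcard]; have := Γ.two_le; omega :
    1 < #{z | G.Adj x z ∧ G.Adj y z})
  simp only [mem_filter, mem_univ, true_and] at hw hw'
  obtain ⟨ℓ, hℓ, hxℓ, hwℓ⟩ := Γ.lines.cover x w hw.1
  obtain ⟨m, hm, hym, hwm⟩ := Γ.lines.cover y w' hw'.2
  have hyℓ : y ∉ ℓ := fun h => hxy (Γ.lines.adj ℓ hℓ x hxℓ y h hne)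
  have hxm : x ∉ m := fun h => hxy (Γ.lines.adj m hm x h y hym hne)
  have hw'ℓ : w' ∉ ℓ := fun h => hww (Γ.neighbour_unique hℓ hyℓ hwℓ h hw.2 hw'.2)
  have hwm' : w ∉ m := fun h => hww (Γ.neighbour_unique hm hxm h hwm hw.1 hw'.1)
  refine Γ.not_isOpposite hℓ hm (Γ.opposite_of_dist hm hℓ ?_ hxℓ hwℓ hw.1.ne hym hwm hw'.2.ne
    hd.le ?_ ?_ ?_)
  · rw [Finset.disjoint_left]
    intro v hvℓ hvm
    have hyv : y ≠ v := fun h => hyℓ (h ▸ hvℓ)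
    have := Γ.neighbour_unique hℓ hyℓ hvℓ hwℓ (Γ.lines.adj m hm y hym v hvm hyv) hw.2
    exact hwm' (this ▸ hvm)
  · rw [dist_eq_one_iff_adj.2 hw'.1]; omega
  · rw [dist_eq_one_iff_adj.2 hw.2.symm]; omega
  · exact Γ.dist_le_two_of_mem hm hym hwm hw.2.symm

end IsGeometry

lemma card_adj_eq_add (hG : G.Connected) {x y : V} {i : ℕ} (hxy : G.dist x y = i + 1) :
    #{z | G.Adj y z} = #{z | G.Adj y z ∧ G.dist x z = i} +
      #{z | G.Adj y z ∧ G.dist x z = i + 1} + #{z | G.Adj y z ∧ G.dist x z = i + 2} := by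
  rw [← card_union_of_disjoint, ← card_union_of_disjoint]
  · congr 1
    ext z
    simp only [mem_union, mem_filter, mem_univ, true_and]
    constructor
    · intro hyz
      have h1 := hG.dist_triangle (u := x) (v := y) (w := z)
      have h2 := hG.dist_triangle (u := x) (v := z) (w := y)
      rw [dist_eq_one_iff_adj.2 hyz] at h1
      rw [dist_eq_one_iff_adj.2 hyz.symm] at h2
      have : G.dist x z = i ∨ G.dist x z = i + 1 ∨ G.dist x z = i + 2 := by omega
      tauto
    · tauto
  · rw [Finset.disjoint_left]
    intro z hz hz'
    simp only [mem_union, mem_filter, mem_univ, true_and] at hz hz'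
    omega
  · rw [Finset.disjoint_left]
    intro z hz hz'
    simp only [mem_filter, mem_univ, true_and] at hz hz'
    omega

lemma HasClassicalParams.isClassical {D : ℕ} {β : ℝ} {cc aa bb : ℕ → ℕ}
    (h : HasClassicalParams G D b 0 β cc aa bb) : IsClassical G D b β := by
  obtain ⟨⟨hconn, hle, hex, hcount⟩, hbb, hcc⟩ := h
  have hset : ∀ (x y : V) (i : ℕ), {z : V | G.Adj y z ∧ G.dist x z = i}.ncard =
      #{z | G.Adj y z ∧ G.dist x z = i} := fun x y i => by
    rw [← Set.ncard_coe_finset]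
    simp
  simp only [hset] at hcount
  have hlower : ∀ i x y, G.dist x y = i + 1 →
      (#{z | G.Adj y z ∧ G.dist x z = i} : ℝ) = gauss b (i + 1) := by
    intro i x y hxy
    have hi : i + 1 ≤ D := hxy ▸ hle x y
    have h1 := (hcount (i + 1) hi x y hxy).1
    rw [Nat.add_sub_cancel] at h1
    rw [h1, hcc (i + 1) (by omega) hi]
    ring
  have hupper : ∀ i x y, G.dist x y = i →
      (#{z | G.Adj y z ∧ G.dist x z = i + 1} : ℝ) = (gauss b D - gauss b i) * β := by
    intro i x y hxy
    have hi : i ≤ D := hxy ▸ hle x y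
    rcases hi.lt_or_eq with hlt | rfl
    · rw [(hcount i hi x y hxy).2.2, hbb i (by omega)]
      ring
    · rw [sub_self, zero_mul, Nat.cast_eq_zero, card_eq_zero, filter_eq_empty_iff]
      rintro z - ⟨-, hz⟩
      have := hle x z
      omega
  have hdeg : ∀ x, (#{z | G.Adj x z} : ℝ) = gauss b D * β := by
    intro x
    have := hupper 0 x x (by simp)
    simpa [dist_eq_one_iff_adj, gauss_zero] using this
  refine ⟨hconn, hle, hex, hlower, fun i x y hxy => ?_, hupper⟩
  cases i with
  | zero =>
    obtain rfl : x = y := hconn.dist_eq_zero_iff.1 hxy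
    rw [gauss_zero, zero_mul, Nat.cast_eq_zero, card_eq_zero, filter_eq_empty_iff]
    rintro z - ⟨hz, hz0⟩
    exact hz.ne (hconn.dist_eq_zero_iff.1 hz0)
  | succ i =>
    have h1 := hdeg y
    rw [card_adj_eq_add hconn hxy, Nat.cast_add, Nat.cast_add, hlower i x y hxy,
      hupper (i + 1) x y hxy] at h1
    linarith

lemma IsClassical.localParams {D : ℕ} (C : IsClassical G D b s) (hr : gauss b D = r) :
    LocalParams G r b s := by
  have hg2 : gauss b 2 = b + 1 := by
    rw [gauss_succ, gauss_one, pow_one, add_comm]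
  have hg3 : gauss b 3 = b ^ 2 + b + 1 := by
    rw [gauss_succ, hg2]
    ring
  refine ⟨C.conn, fun x => ?_, fun x y hxy => ?_, fun x y hxy => ?_, fun x y hxy => ?_,
    fun x y hxy => ?_⟩
  · have := C.upper 0 x x (by simp)
    simp only [zero_add, dist_eq_one_iff_adj, and_self, gauss_zero, sub_zero, hr] at this
    exact_mod_cast this
  · have := C.same 1 x y (dist_eq_one_iff_adj.2 hxy)
    simp only [dist_eq_one_iff_adj, gauss_one, one_mul] at this
    have h : (#{z | G.Adj x z ∧ G.Adj y z} : ℝ) + 1 = s := by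
      simp only [and_comm (a := G.Adj x _)]
      linarith
    exact_mod_cast h
  · have := C.lower 1 x y hxy
    simp only [dist_eq_one_iff_adj, Nat.reduceAdd, hg2] at this
    simp only [and_comm (a := G.Adj x _)]
    exact_mod_cast this
  · have := C.same 2 x y hxy
    rw [hg2] at this
    have h : (#{z | G.Adj y z ∧ G.dist x z = 2} : ℝ) + (b + 1) = (b + 1) * s := by
      linarith
    exact_mod_cast h
  · have := C.lower 2 x y hxy
    simp only [Nat.reduceAdd, hg3] at this
    exact_mod_cast this

lemma IsClassical.exists_dist_eq {D : ℕ} {β : ℝ} (C : IsClassical G D b β) {i : ℕ} (hi : i ≤ D) :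
    ∃ x y, G.dist x y = i := by
  obtain ⟨x, y, hxy⟩ := C.exists_dist
  obtain ⟨p, hp⟩ := C.conn.exists_walk_length_eq_dist x y
  refine ⟨x, p.getVert i, le_antisymm ?_ ?_⟩
  · exact (SimpleGraph.dist_le (p.take i)).trans (by simp)
  · have h1 := C.conn.dist_triangle (u := x) (v := p.getVert i) (w := y)
    have h2 := SimpleGraph.dist_le (p.drop i)
    rw [Walk.drop_length] at h2
    omega

/-- If the classical parameters are `(D, b, 0, s)`, then `s` is not too large. -/
lemma IsClassical.lt_bound {D : ℕ} (C : IsClassical G D b s) (hb : 2 ≤ b) (hD : 2 ≤ D)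
    (hr : gauss b D = r) : s < 2 * r * (b + 1) ^ 2 := by
  by_contra! hs
  have P := C.localParams hr
  have hr1 : 1 ≤ r := by
    have h := gauss_mono b (show 1 ≤ D by omega)
    rw [gauss_one, hr] at h
    exact_mod_cast h
  obtain ⟨L, H, hsz⟩ := P.exists_lineSystem hr1 hs
  have hL : IsLineSystem.IsLarge L r b s := ⟨hr1, by omega, hs, hsz⟩
  have Γ : IsGeometry G L r b s :=
    ⟨H, P, fun ℓ hℓ => H.card_line P hL C hr hℓ, hb, lt_of_lt_of_le (by nlinarith) hs⟩
  obtain ⟨x, y, hxy⟩ := C.exists_dist_eq hD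
  exact Γ.dist_ne_two x y hxy

lemma gauss_eq_cast (b j : ℕ) : gauss b j = ((∑ i ∈ range j, b ^ i : ℕ) : ℝ) := by
  simp [gauss]

lemma IsClassical.exists_nat_eq {D : ℕ} {β : ℝ} (C : IsClassical G D b β) (hD : 1 ≤ D) :
    ∃ s : ℕ, β = s := by
  obtain ⟨x, y, hxy⟩ := C.exists_dist_eq hD
  have h := C.same 1 x y hxy
  rw [gauss_one, one_mul] at h
  exact ⟨#{z | G.Adj y z ∧ G.dist x z = 1} + 1, by push_cast; linarith⟩

lemma IsClassical.beta_lt {D : ℕ} {β : ℝ} (C : IsClassical G D b β) (hb : 2 ≤ b) (hD : 2 ≤ D) :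
    β < 2 * (b + 1) ^ 2 * gauss b D := by
  obtain ⟨s, rfl⟩ := C.exists_nat_eq (by omega)
  have h := C.lt_bound hb hD (gauss_eq_cast b D)
  rw [gauss_eq_cast]
  have : (s : ℝ) < 2 * ((∑ i ∈ range D, b ^ i : ℕ) : ℝ) * (b + 1) ^ 2 := by exact_mod_cast h
  linarith

end

/-- if `Γ` has classical parameters `(D, b, 0, β)` with `b ≥ 2`, `D ≥ 3`, then
`β < 2((b+2)/(2b+3))(b³ + 2b² + 3b - 1)r` where `r = [D]`. -/
theorem statement_13 {V : Type*} [Fintype V] (G : SimpleGraph V) (D b : ℕ) (β : ℝ)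
    (cc aa bb : ℕ → ℕ) (hb : 2 ≤ b) (hD : 3 ≤ D)
    (h : HasClassicalParams G D b 0 β cc aa bb) :
    β < 2 * (((b : ℝ) + 2) / (2 * (b : ℝ) + 3))
        * ((b : ℝ) ^ 3 + 2 * (b : ℝ) ^ 2 + 3 * (b : ℝ) - 1) * gauss b D := by
  have hlt := h.isClassical.beta_lt hb (by omega)
  have hb' : (2 : ℝ) ≤ b := by exact_mod_cast hb
  have hg : 0 ≤ gauss b D := (gauss_zero b).symm.le.trans (gauss_mono b (Nat.zero_le D))
  refine hlt.trans_le (mul_le_mul_of_nonneg_right ?_ hg)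
  have h1 : 1 ≤ 2 * (((b : ℝ) + 2) / (2 * (b : ℝ) + 3)) := by
    rw [← mul_div_assoc, le_div_iff₀ (by linarith)]
    linarith
  have h2 : 2 * ((b : ℝ) + 1) ^ 2 ≤ (b : ℝ) ^ 3 + 2 * (b : ℝ) ^ 2 + 3 * (b : ℝ) - 1 := by
    nlinarith [sq_nonneg ((b : ℝ) - 2), mul_nonneg (sq_nonneg (b : ℝ)) (sub_nonneg.2 hb')]
  exact h2.trans (le_mul_of_one_le_left (by nlinarith) h1)
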